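/- (Corollary 5 of the paper, in coordinates.) Let U ⊆ ℝⁿ (n ≥ 2) be open and connected, and let (g, ω) and (ḡ, ω̄) be Randers data on U. Suppose they are pointwise projectively related, i.e. every forward Randers geodesic of (g, ω) is either a forward Randers geodesic of (ḡ, ω̄) or a forward Randers geodesic of (ḡ, −ω̄). Suppose moreover that ω is not closed, i.e. dω is not identically zero on U. Then there exists a real constant c > 0 such that g(p) = c²·ḡ(p) for every p ∈ U, and for every point p ∈ U one has (dω)_p = c·(dω̄)_p or (dω)_p = −c·(dω̄)_p. -/

import Mathlib

open Matrix

/-- The partial derivative `∂f/∂x^k` of a scalar function on `ℝⁿ` at a point `p`. -/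
noncomputable def dpart {n : ℕ} (f : (Fin n → ℝ) → ℝ) (k : Fin n) (p : Fin n → ℝ) : ℝ :=
  fderiv ℝ f p (Pi.single k 1)

/-- The differential `dω` of a 1-form `ω` (given by its components), as a
skew-symmetric-matrix-valued map: `(dω)_{ik} = ∂ω_i/∂x^k − ∂ω_k/∂x^i`. -/
noncomputable def dform {n : ℕ} (ω : (Fin n → ℝ) → (Fin n → ℝ)) (p : Fin n → ℝ) :
    Matrix (Fin n) (Fin n) ℝ :=
  Matrix.of fun i k => dpart (fun q => ω q i) k p - dpart (fun q => ω q k) i p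

/-- The 1-form `ω` is closed on `U`. -/
def IsClosedFormOn {n : ℕ} (U : Set (Fin n → ℝ)) (ω : (Fin n → ℝ) → (Fin n → ℝ)) : Prop :=
  ∀ p ∈ U, dform ω p = 0

/-- `(g, ω)` is a Randers datum on `U`: `g` is a `C²` field of symmetric positive-definite
matrices and `ω` is a `C²` field of components of a 1-form. -/
def IsRandersDatum {n : ℕ} (U : Set (Fin n → ℝ))
    (g : (Fin n → ℝ) → Matrix (Fin n) (Fin n) ℝ)
    (ω : (Fin n → ℝ) → (Fin n → ℝ)) : Prop :=
  (∀ p ∈ U, (g p).IsSymm ∧ (g p).PosDef) ∧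
  (∀ i j, ContDiffOn ℝ 2 (fun q => g q i j) U) ∧
  (∀ i, ContDiffOn ℝ 2 (fun q => ω q i) U)

/-- `x : I → U` is a forward Randers geodesic of `(g, ω)`: `I` is an open interval, `x` is a
`C²` curve in `U` with nowhere-vanishing derivative satisfying the Euler–Lagrange equation of
the Randers length functional. -/
def IsRandersGeodesic {n : ℕ} (U : Set (Fin n → ℝ))
    (g : (Fin n → ℝ) → Matrix (Fin n) (Fin n) ℝ)
    (ω : (Fin n → ℝ) → (Fin n → ℝ))
    (I : Set ℝ) (x : ℝ → (Fin n → ℝ)) : Prop :=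
  IsOpen I ∧ I.OrdConnected ∧ (∀ t ∈ I, x t ∈ U) ∧
  ContDiffOn ℝ 2 x I ∧ (∀ t ∈ I, deriv x t ≠ 0) ∧
  ∀ t ∈ I, ∀ j : Fin n,
    deriv (deriv x) t j / Real.sqrt (∑ k, ∑ m, g (x t) k m * deriv x t k * deriv x t m)
    + deriv x t j *
        deriv (fun s => 1 / Real.sqrt (∑ k, ∑ m, g (x s) k m * deriv x s k * deriv x s m)) t
    + (1 / Real.sqrt (∑ k, ∑ m, g (x t) k m * deriv x t k * deriv x t m)) *
        ∑ i, ∑ k, ∑ p, (g (x t))⁻¹ j i * dpart (fun q => g q i p) k (x t) *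
          deriv x t k * deriv x t p
    + ∑ i, ∑ k, (g (x t))⁻¹ j i *
        (dpart (fun q => ω q i) k (x t) - dpart (fun q => ω q k) i (x t)) * deriv x t k
    - (1 / (2 * Real.sqrt (∑ k, ∑ m, g (x t) k m * deriv x t k * deriv x t m))) *
        ∑ i, ∑ p, ∑ q, (g (x t))⁻¹ j i * dpart (fun r => g r p q) i (x t) *
          deriv x t p * deriv x t q
    = 0

open Polynomial in
theorem Polynomial.eq_C_mul_of_dvd_of_natDegree_le {N p : ℝ[X]} (hN : N ≠ 0)
    (hp : p.natDegree ≤ N.natDegree) (h : N ∣ p) : ∃ k : ℝ, p = C k * N := by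
  obtain ⟨q, rfl⟩ := h
  rcases eq_or_ne q 0 with rfl | hq
  · exact ⟨0, by simp⟩
  · rw [natDegree_mul hN hq] at hp
    refine ⟨q.coeff 0, ?_⟩
    rw [← eq_C_of_natDegree_le_zero (by omega), mul_comm]

open Polynomial in
theorem Polynomial.proportional_of_mul_sq_eq {N M a b : ℝ[X]} (hN : Irreducible N)
    (hM : Irreducible M) (hN2 : N.natDegree = 2) (hM2 : M.natDegree = 2)
    (ha2 : a.natDegree ≤ 2) (hb2 : b.natDegree ≤ 2) (ha : a ≠ 0)
    (h : N * a ^ 2 = M * b ^ 2) : ∃ k : ℝ, M = C k * N := by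
  have hdvd : N ∣ M * b ^ 2 := ⟨_, h.symm⟩
  rcases hN.prime.dvd_or_dvd hdvd with h1 | h1
  · exact eq_C_mul_of_dvd_of_natDegree_le hN.ne_zero (by omega) h1
  obtain ⟨k, rfl⟩ := eq_C_mul_of_dvd_of_natDegree_le hN.ne_zero (by omega)
    (hN.prime.dvd_of_dvd_pow h1)
  have h2 : a ^ 2 = M * (C (k ^ 2) * N) := by
    apply mul_left_cancel₀ hN.ne_zero
    rw [h, C_pow]; ring
  obtain ⟨l, rfl⟩ := eq_C_mul_of_dvd_of_natDegree_le hM.ne_zero (by omega)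
    (hM.prime.dvd_of_dvd_pow ⟨_, h2⟩)
  have h3 : C (l ^ 2) * M = C (k ^ 2) * N := by
    apply mul_left_cancel₀ hM.ne_zero
    rw [← h2, C_pow]; ring
  have hl : l ≠ 0 := by rintro rfl; simp at ha
  refine ⟨(l ^ 2)⁻¹ * k ^ 2, ?_⟩
  rw [C_mul, mul_assoc, ← h3, ← mul_assoc, ← C_mul, inv_mul_cancel₀ (by positivity)]
  simp

open Polynomial in
theorem Polynomial.eq_zero_of_sq_eq_mul_sq {N d b : ℝ[X]} (hN : Irreducible N)
    (hN2 : N.natDegree = 2) (hd : d.natDegree ≤ 3) (hb : b.natDegree ≤ 2)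
    (h : d ^ 2 = N * b ^ 2) : b = 0 := by
  obtain ⟨e, rfl⟩ := hN.prime.dvd_of_dvd_pow ⟨_, h⟩
  have h1 : N * e ^ 2 = b ^ 2 := by
    apply mul_left_cancel₀ hN.ne_zero
    rw [← h]; ring
  obtain ⟨k, rfl⟩ := eq_C_mul_of_dvd_of_natDegree_le hN.ne_zero (by omega)
    (hN.prime.dvd_of_dvd_pow ⟨_, h1.symm⟩)
  have h2 : e ^ 2 = N * C (k ^ 2) := by
    apply mul_left_cancel₀ hN.ne_zero
    rw [h1, C_pow]; ring
  have he : e = 0 := by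
    by_contra he
    have h3 := natDegree_le_of_dvd (hN.prime.dvd_of_dvd_pow ⟨_, h2⟩) he
    rw [natDegree_mul hN.ne_zero he] at hd
    omega
  rw [he] at h1
  simpa using h1.symm

/-- The restriction of `f` to every affine line is a polynomial of degree at most `d`. -/
def PolyOnLines {n : ℕ} (d : ℕ) (f : (Fin n → ℝ) → ℝ) : Prop :=
  ∀ u w : Fin n → ℝ, ∃ p : Polynomial ℝ, p.natDegree ≤ d ∧ ∀ t : ℝ, p.eval t = f (u + t • w)

namespace PolyOnLines

variable {n d e : ℕ} {f h : (Fin n → ℝ) → ℝ}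

theorem coord (i : Fin n) : PolyOnLines 1 (fun v : Fin n → ℝ => v i) := fun u w =>
  ⟨Polynomial.C (w i) * Polynomial.X + Polynomial.C (u i), Polynomial.natDegree_linear_le,
    fun t => by simp; ring⟩

theorem mul (hf : PolyOnLines d f) (hh : PolyOnLines e h) :
    PolyOnLines (d + e) (fun v => f v * h v) := fun u w => by
  obtain ⟨p, hp, hp'⟩ := hf u w
  obtain ⟨q, hq, hq'⟩ := hh u w
  exact ⟨p * q, Polynomial.natDegree_mul_le.trans (by omega), fun t => by simp [hp', hq']⟩

theorem sub (hf : PolyOnLines d f) (hh : PolyOnLines d h) :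
    PolyOnLines d (fun v => f v - h v) := fun u w => by
  obtain ⟨p, hp, hp'⟩ := hf u w
  obtain ⟨q, hq, hq'⟩ := hh u w
  exact ⟨p - q, (Polynomial.natDegree_sub_le _ _).trans (by omega), fun t => by simp [hp', hq']⟩

theorem const_mul (c : ℝ) (hf : PolyOnLines d f) : PolyOnLines d (fun v => c * f v) :=
  fun u w => by
  obtain ⟨p, hp, hp'⟩ := hf u w
  exact ⟨Polynomial.C c * p, (Polynomial.natDegree_C_mul_le _ _).trans hp,
    fun t => by simp [hp']⟩

theorem sum {F : Fin n → (Fin n → ℝ) → ℝ} (hF : ∀ i, PolyOnLines d (F i)) :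
    PolyOnLines d (fun v => ∑ i, F i v) := fun u w => by
  choose p hp hp' using fun i => hF i u w
  exact ⟨∑ i, p i, Polynomial.natDegree_sum_le_of_forall_le _ _ fun i _ => hp i,
    fun t => by simp [Polynomial.eval_finsetSum, hp']⟩

theorem mulVec (A : Matrix (Fin n) (Fin n) ℝ) (i : Fin n) :
    PolyOnLines 1 (fun v => (A *ᵥ v) i) := by
  simp only [Matrix.mulVec, dotProduct]
  exact sum fun k => (coord k).const_mul _

end PolyOnLines

/-- The quadratic form of a matrix. -/
def quad {n : ℕ} (G : Matrix (Fin n) (Fin n) ℝ) (v : Fin n → ℝ) : ℝ :=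
  ∑ k, ∑ m, G k m * v k * v m

section quad

variable {n : ℕ} {G H : Matrix (Fin n) (Fin n) ℝ}

theorem quad_eq_dotProduct (v : Fin n → ℝ) : quad G v = v ⬝ᵥ G *ᵥ v := by
  simp only [quad, dotProduct, Matrix.mulVec, Finset.mul_sum]
  exact Finset.sum_congr rfl fun k _ => Finset.sum_congr rfl fun m _ => by ring

theorem quad_pos (hG : G.PosDef) {v : Fin n → ℝ} (hv : v ≠ 0) : 0 < quad G v := by
  simpa [quad_eq_dotProduct] using hG.dotProduct_mulVec_pos hv

theorem quad_smul (s : ℝ) (v : Fin n → ℝ) : quad G (s • v) = s ^ 2 * quad G v := by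
  simp [quad_eq_dotProduct, Matrix.mulVec_smul]; ring

theorem quad_neg (v : Fin n → ℝ) : quad G (-v) = quad G v := by
  simp [quad_eq_dotProduct, Matrix.mulVec_neg]

theorem quad_smul_matrix (s : ℝ) (v : Fin n → ℝ) : quad (s • G) v = s * quad G v := by
  simp [quad_eq_dotProduct, Matrix.smul_mulVec]

theorem quad_sub_matrix (v : Fin n → ℝ) : quad (G - H) v = quad G v - quad H v := by
  simp [quad_eq_dotProduct, Matrix.sub_mulVec]

theorem Matrix.IsSymm.dotProduct_mulVec_comm (hG : G.IsSymm) (v w : Fin n → ℝ) :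
    v ⬝ᵥ G *ᵥ w = w ⬝ᵥ G *ᵥ v := by
  rw [dotProduct_mulVec, ← mulVec_transpose, hG.eq, dotProduct_comm]

theorem quad_add_smul (hG : G.IsSymm) (u w : Fin n → ℝ) (t : ℝ) :
    quad G (u + t • w) = quad G w * t ^ 2 + 2 * (u ⬝ᵥ G *ᵥ w) * t + quad G u := by
  simp only [quad_eq_dotProduct, Matrix.mulVec_add, Matrix.mulVec_smul, dotProduct_add,
    add_dotProduct, dotProduct_smul, smul_dotProduct, smul_eq_mul]
  rw [hG.dotProduct_mulVec_comm w u]; ring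

theorem eq_zero_of_quad_eq_zero (hG : G.IsSymm) (h : ∀ v, quad G v = 0) : G = 0 := by
  have h1 : ∀ v w : Fin n → ℝ, v ⬝ᵥ G *ᵥ w = 0 := fun v w => by
    have := quad_add_smul hG v w 1
    simp only [h] at this
    linarith
  ext i j
  simpa using h1 (Pi.single i 1) (Pi.single j 1)

theorem continuous_quad : Continuous (quad G) := by
  unfold quad; fun_prop

theorem exists_irreducible_quad_line (hG : G.IsSymm) (hG' : G.PosDef) {u w : Fin n → ℝ}
    (hw : w ≠ 0) (huw : ∀ t : ℝ, u + t • w ≠ 0) :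
    ∃ p : Polynomial ℝ, Irreducible p ∧ p.natDegree = 2 ∧ ∀ t, p.eval t = quad G (u + t • w) := by
  have heval : ∀ t : ℝ, (Polynomial.C (quad G w) * Polynomial.X ^ 2 +
      Polynomial.C (2 * (u ⬝ᵥ G *ᵥ w)) * Polynomial.X + Polynomial.C (quad G u)).eval t =
      quad G (u + t • w) := fun t => by
    rw [quad_add_smul hG]; simp
  have hdeg := Polynomial.natDegree_quadratic (a := quad G w) (b := 2 * (u ⬝ᵥ G *ᵥ w))
    (c := quad G u) (quad_pos hG' hw).ne'
  refine ⟨_, Polynomial.irreducible_of_degree_le_three_of_not_isRoot ?_ fun t ht => ?_, hdeg, heval⟩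
  · rw [hdeg]; decide
  · rw [Polynomial.IsRoot, heval] at ht
    exact (quad_pos hG' (huw t)).ne' ht

theorem quad_proportional_of_mul_sq_eq (hG : G.IsSymm) (hG' : G.PosDef) (hH : H.IsSymm)
    (hH' : H.PosDef) {a b : (Fin n → ℝ) → ℝ} (ha : PolyOnLines 2 a) (hb : PolyOnLines 2 b)
    (h : ∀ v, quad G v * a v ^ 2 = quad H v * b v ^ 2) {u : Fin n → ℝ} (hu : a u ≠ 0)
    (hu0 : u ≠ 0) (v : Fin n → ℝ) : quad G v * quad H u = quad H v * quad G u := by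
  by_cases hpar : ∃ s : ℝ, v = s • u
  · obtain ⟨s, rfl⟩ := hpar
    rw [quad_smul, quad_smul]; ring
  have hline : ∀ t : ℝ, u + t • (v - u) ≠ 0 := fun t ht => by
    rcases eq_or_ne t 0 with rfl | ht0
    · simp [hu0] at ht
    · refine hpar ⟨1 - t⁻¹, ?_⟩
      have h1 : t⁻¹ • (u + t • (v - u)) = 0 := by rw [ht, smul_zero]
      rw [smul_add, smul_smul, inv_mul_cancel₀ ht0, one_smul] at h1
      rw [sub_smul, one_smul]
      linear_combination h1
  have hw : v - u ≠ 0 := fun h0 => hpar ⟨1, by rw [one_smul]; exact sub_eq_zero.mp h0⟩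
  obtain ⟨N, hN, hN2, hNe⟩ := exists_irreducible_quad_line hG hG' hw hline
  obtain ⟨M, hM, hM2, hMe⟩ := exists_irreducible_quad_line hH hH' hw hline
  obtain ⟨p, hp, hpe⟩ := ha u (v - u)
  obtain ⟨q, hq, hqe⟩ := hb u (v - u)
  obtain ⟨k, hk⟩ := Polynomial.proportional_of_mul_sq_eq hN hM hN2 hM2 hp hq
    (by rintro rfl; have := hpe 0; simp at this; exact hu this.symm)
    (Polynomial.funext fun t => by simp [hNe, hMe, hpe, hqe, h])
  have h0 := hMe 0
  have h1 := hMe 1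
  rw [hk, Polynomial.eval_mul, hNe, Polynomial.eval_C] at h0 h1
  simp only [zero_smul, add_zero, one_smul, add_sub_cancel] at h0 h1
  rw [← h0, ← h1]; ring

theorem eq_zero_of_sq_eq_quad_mul_sq (hn : 2 ≤ n) (hG : G.IsSymm) (hG' : G.PosDef)
    {d b : (Fin n → ℝ) → ℝ} (hd : PolyOnLines 3 d) (hb : PolyOnLines 2 b)
    (h : ∀ v, d v ^ 2 = quad G v * b v ^ 2) {u : Fin n → ℝ} (hu : u ≠ 0) : b u = 0 := by
  obtain ⟨w, hw⟩ : ∃ w, w ∉ Submodule.span ℝ {u} := by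
    by_contra! hall
    have h1 : Submodule.span ℝ {u} = ⊤ := Submodule.eq_top_iff'.mpr hall
    have h2 := finrank_span_singleton (K := ℝ) hu
    rw [h1, finrank_top, Module.finrank_fin_fun] at h2
    omega
  rw [Submodule.mem_span_singleton] at hw
  push Not at hw
  have hline : ∀ t : ℝ, u + t • w ≠ 0 := fun t ht => by
    rcases eq_or_ne t 0 with rfl | ht0
    · simp [hu] at ht
    · refine hw (-t⁻¹) ?_
      have h1 : t⁻¹ • (u + t • w) = 0 := by rw [ht, smul_zero]
      rw [smul_add, smul_smul, inv_mul_cancel₀ ht0, one_smul] at h1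
      rw [neg_smul]
      linear_combination -h1
  obtain ⟨N, hN, hN2, hNe⟩ := exists_irreducible_quad_line hG hG'
    (fun h0 => hw 0 (by rw [h0, zero_smul])) hline
  obtain ⟨p, hp, hpe⟩ := hd u w
  obtain ⟨q, hq, hqe⟩ := hb u w
  have hq0 := Polynomial.eq_zero_of_sq_eq_mul_sq hN hN2 hp hq
    (Polynomial.funext fun t => by simp [hNe, hpe, hqe, h])
  have := hqe 0
  simpa [hq0] using this.symm

end quad

section pointwise

variable {n : ℕ} {G H Ω Θ : Matrix (Fin n) (Fin n) ℝ}

theorem Matrix.eq_zero_of_forall_mulVec {A : Matrix (Fin n) (Fin n) ℝ}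
    (h : ∀ v, A *ᵥ v = 0) : A = 0 :=
  Matrix.toLin'.injective (LinearMap.ext fun v => by rw [Matrix.toLin'_apply, h v]; simp)

theorem dotProduct_mulVec_self_of_skew (hΩ : Ωᵀ = -Ω) (v : Fin n → ℝ) : v ⬝ᵥ Ω *ᵥ v = 0 := by
  have h : v ⬝ᵥ Ω *ᵥ v = -(v ⬝ᵥ Ω *ᵥ v) := by
    conv_lhs => rw [dotProduct_mulVec, ← mulVec_transpose, hΩ, dotProduct_comm]
    rw [neg_mulVec, dotProduct_neg]
  linarith

theorem Matrix.PosDef.mul_inv_mul_cancel (hG : G.PosDef) (Ω : Matrix (Fin n) (Fin n) ℝ) :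
    G * (G⁻¹ * Ω) = Ω := by
  rw [← Matrix.mul_assoc, Matrix.mul_nonsing_inv _ ((Matrix.isUnit_iff_isUnit_det _).mp hG.isUnit),
    Matrix.one_mul]

theorem dotProduct_mulVec_inv_mul_of_skew (hG : G.PosDef) (hΩ : Ωᵀ = -Ω) (v : Fin n → ℝ) :
    v ⬝ᵥ G *ᵥ (G⁻¹ * Ω) *ᵥ v = 0 := by
  rw [Matrix.mulVec_mulVec, hG.mul_inv_mul_cancel, dotProduct_mulVec_self_of_skew hΩ]

theorem inv_mul_mulVec_eq_zero_of_parallel (hGs : G.IsSymm) (hG : G.PosDef) (hΩ : Ωᵀ = -Ω)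
    {v : Fin n → ℝ}
    (h : ∀ i j, ((G⁻¹ * Ω) *ᵥ v) i * v j - ((G⁻¹ * Ω) *ᵥ v) j * v i = 0) :
    (G⁻¹ * Ω) *ᵥ v = 0 := by
  rcases eq_or_ne v 0 with rfl | hv
  · simp
  set y := (G⁻¹ * Ω) *ᵥ v with hy
  have h0 : y ⬝ᵥ G *ᵥ v = 0 := by
    rw [hGs.dotProduct_mulVec_comm]
    exact dotProduct_mulVec_inv_mul_of_skew hG hΩ v
  funext i
  have h1 : y i * (v ⬝ᵥ G *ᵥ v) = (y ⬝ᵥ G *ᵥ v) * v i := by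
    simp only [dotProduct, Finset.mul_sum, Finset.sum_mul]
    refine Finset.sum_congr rfl fun j _ => ?_
    linear_combination (G *ᵥ v) j * h i j
  rw [h0, zero_mul, ← quad_eq_dotProduct] at h1
  exact (mul_eq_zero.mp h1).resolve_right (quad_pos hG hv).ne'

theorem eq_or_eq_neg_of_forall_mulVec {A B : Matrix (Fin n) (Fin n) ℝ} (hA : A ≠ 0)
    (h : ∀ v, A *ᵥ v ≠ 0 → A *ᵥ v = B *ᵥ v ∨ A *ᵥ v = -(B *ᵥ v)) : A = B ∨ A = -B := by
  have hcov : ⋃ i, ((![LinearMap.ker A.mulVecLin, LinearMap.ker (A - B).mulVecLin,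
      LinearMap.ker (A + B).mulVecLin] i : Submodule ℝ (Fin n → ℝ)) : Set (Fin n → ℝ)) =
      Set.univ := by
    refine Set.eq_univ_of_forall fun v => Set.mem_iUnion.mpr ?_
    by_cases hv : A *ᵥ v = 0
    · exact ⟨0, by simpa using hv⟩
    · rcases h v hv with h1 | h1
      · exact ⟨1, by simp [h1]⟩
      · exact ⟨2, by simp [h1]⟩
  have hker : ∀ C : Matrix (Fin n) (Fin n) ℝ, LinearMap.ker C.mulVecLin = ⊤ → C = 0 :=
    fun C hC => by
    rw [LinearMap.ker_eq_top] at hC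
    apply Matrix.toLin'.injective
    rw [Matrix.toLin'_apply', hC, map_zero]
  obtain ⟨i, hi⟩ := Subspace.exists_eq_top_of_iUnion_eq_univ hcov
  fin_cases i
  · exact absurd (hker _ hi) hA
  · exact Or.inl (sub_eq_zero.mp (hker _ hi))
  · exact Or.inr (eq_neg_of_add_eq_zero_left (hker _ hi))

theorem dense_setOf_mulVec_ne_zero {A : Matrix (Fin n) (Fin n) ℝ} (hA : A ≠ 0) :
    Dense {v | A *ᵥ v ≠ 0} := by
  have h1 : {v | A *ᵥ v ≠ 0} = ((LinearMap.ker A.mulVecLin : Submodule ℝ (Fin n → ℝ)) :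
      Set (Fin n → ℝ))ᶜ := by
    ext v; simp
  rw [h1, ← interior_eq_empty_iff_dense_compl]
  by_contra h2
  have h3 := Submodule.eq_top_of_nonempty_interior' _ (Set.nonempty_iff_ne_empty.mpr h2)
  rw [LinearMap.ker_eq_top] at h3
  refine hA (Matrix.toLin'.injective ?_)
  rw [Matrix.toLin'_apply', h3, map_zero]

/-- The alternative obtained by comparing the geodesics through `v` and `-v`. -/
theorem wedge_alternative (hGs : G.IsSymm) (hG : G.PosDef) (hH : H.PosDef) (hΩ : Ωᵀ = -Ω)
    {B : Matrix (Fin n) (Fin n) ℝ}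
    {D : (Fin n → ℝ) → (Fin n → ℝ)} (hDneg : ∀ v, D (-v) = D v)
    (h : ∀ v, v ≠ 0 → ∃ ε : ℝ, (ε = 1 ∨ ε = -1) ∧ ∃ r : ℝ,
      D v - √(quad G v) • ((G⁻¹ * Ω) *ᵥ v) + (ε * √(quad H v)) • (B *ᵥ v) = r • v)
    (v : Fin n → ℝ) :
    (∀ i j, D v i * v j - D v j * v i = 0 ∧
      quad G v * (((G⁻¹ * Ω) *ᵥ v) i * v j - ((G⁻¹ * Ω) *ᵥ v) j * v i) ^ 2 =
        quad H v * ((B *ᵥ v) i * v j - (B *ᵥ v) j * v i) ^ 2) ∨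
    ((G⁻¹ * Ω) *ᵥ v = 0 ∧ ∀ i j, (D v i * v j - D v j * v i) ^ 2 =
      quad H v * ((B *ᵥ v) i * v j - (B *ᵥ v) j * v i) ^ 2) := by
  rcases eq_or_ne v 0 with rfl | hv
  · left; simp
  obtain ⟨ε, hε, r, hr⟩ := h v hv
  obtain ⟨ε', hε', r', hr'⟩ := h (-v) (neg_ne_zero.mpr hv)
  rw [hDneg, quad_neg, quad_neg, mulVec_neg, mulVec_neg] at hr'
  set A := G⁻¹ * Ω with hA
  have hN := Real.sq_sqrt (quad_pos hG hv).le
  have hM := Real.sq_sqrt (quad_pos hH hv).le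
  have hNpos := Real.sqrt_pos.mpr (quad_pos hG hv)
  have hεsq : ε ^ 2 = 1 := by rcases hε with rfl | rfl <;> norm_num
  set a := √(quad G v)
  set b := √(quad H v)
  have e1 : ∀ i j, (D v i * v j - D v j * v i) - a * ((A *ᵥ v) i * v j - (A *ᵥ v) j * v i) +
      ε * b * ((B *ᵥ v) i * v j - (B *ᵥ v) j * v i) = 0 := fun i j => by
    have hi := congrFun hr i
    have hj := congrFun hr j
    simp only [Pi.add_apply, Pi.sub_apply, Pi.smul_apply, smul_eq_mul] at hi hj
    linear_combination v j * hi - v i * hj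
  have e2 : ∀ i j, (D v i * v j - D v j * v i) + a * ((A *ᵥ v) i * v j - (A *ᵥ v) j * v i) -
      ε' * b * ((B *ᵥ v) i * v j - (B *ᵥ v) j * v i) = 0 := fun i j => by
    have hi := congrFun hr' i
    have hj := congrFun hr' j
    simp only [Pi.add_apply, Pi.sub_apply, Pi.smul_apply, Pi.neg_apply, smul_eq_mul] at hi hj
    linear_combination v j * hi - v i * hj
  by_cases hεε : ε' = ε
  · subst hεε
    left
    refine fun i j => ⟨by linarith [e1 i j, e2 i j], ?_⟩
    rw [← hN, ← hM]
    have h3 : a * ((A *ᵥ v) i * v j - (A *ᵥ v) j * v i) =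
      ε' * b * ((B *ᵥ v) i * v j - (B *ᵥ v) j * v i) := by linarith [e1 i j, e2 i j]
    rw [← mul_pow, h3, mul_pow, mul_pow, hεsq]; ring
  · have hneg : ε' = -ε := by
      rcases hε with rfl | rfl <;> rcases hε' with rfl | rfl <;> simp_all
    subst hneg
    right
    have h4 : ∀ i j, (A *ᵥ v) i * v j - (A *ᵥ v) j * v i = 0 := fun i j => by
      have : a * ((A *ᵥ v) i * v j - (A *ᵥ v) j * v i) = 0 := by linarith [e1 i j, e2 i j]
      exact (mul_eq_zero.mp this).resolve_left hNpos.ne'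
    refine ⟨inv_mul_mulVec_eq_zero_of_parallel hGs hG hΩ h4, fun i j => ?_⟩
    have h5 : D v i * v j - D v j * v i =
      -(ε * b * ((B *ᵥ v) i * v j - (B *ᵥ v) j * v i)) := by linarith [e1 i j, e2 i j]
    rw [h5, ← hM, neg_sq, mul_pow, mul_pow, hεsq]; ring

theorem pointwise_relation (hn : 2 ≤ n) (hGs : G.IsSymm) (hG : G.PosDef) (hHs : H.IsSymm)
    (hH : H.PosDef) (hΩ : Ωᵀ = -Ω) (hΘ : Θᵀ = -Θ)
    {D : (Fin n → ℝ) → (Fin n → ℝ)} (hDneg : ∀ v, D (-v) = D v)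
    (hDpoly : ∀ i, PolyOnLines 2 (fun v => D v i)) (hDcont : Continuous D)
    (h : ∀ v, v ≠ 0 → ∃ ε : ℝ, (ε = 1 ∨ ε = -1) ∧ ∃ r : ℝ,
      D v - √(quad G v) • ((G⁻¹ * Ω) *ᵥ v) + (ε * √(quad H v)) • ((H⁻¹ * Θ) *ᵥ v) = r • v) :
    (∀ v i j, D v i * v j - D v j * v i = 0) ∧ (Ω = 0 → Θ = 0) ∧
      (Ω ≠ 0 → ∃ κ : ℝ, 0 < κ ∧ G = κ • H ∧ (Ω = √κ • Θ ∨ Ω = -(√κ • Θ))) := by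
  have halt := wedge_alternative hGs hG hH hΩ hDneg h
  have hwedge : ∀ (A : Matrix (Fin n) (Fin n) ℝ) i j,
      PolyOnLines 2 (fun v => (A *ᵥ v) i * v j - (A *ᵥ v) j * v i) := fun A i j =>
    ((PolyOnLines.mulVec A i).mul (.coord j)).sub ((PolyOnLines.mulVec A j).mul (.coord i))
  have hDwedge : ∀ i j, PolyOnLines 3 (fun v => D v i * v j - D v j * v i) := fun i j =>
    ((hDpoly i).mul (.coord j)).sub ((hDpoly j).mul (.coord i))
  have hDi : ∀ i, Continuous fun v => D v i := fun i => (continuous_apply i).comp hDcont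
  have hAi : ∀ (A : Matrix (Fin n) (Fin n) ℝ) i, Continuous fun v => (A *ᵥ v) i := fun A i =>
    (continuous_apply i).comp (Continuous.matrix_mulVec continuous_const continuous_id)
  by_cases hΩ0 : Ω = 0
  · subst hΩ0
    have hsq : ∀ i j v, (D v i * v j - D v j * v i) ^ 2 =
        quad H v * (((H⁻¹ * Θ) *ᵥ v) i * v j - ((H⁻¹ * Θ) *ᵥ v) j * v i) ^ 2 := fun i j v => by
      rcases halt v with h1 | h1
      · obtain ⟨h2, h3⟩ := h1 i j
        rw [h2, ← h3]; simp
      · exact h1.2 i j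
    have hb : ∀ i j v, ((H⁻¹ * Θ) *ᵥ v) i * v j - ((H⁻¹ * Θ) *ᵥ v) j * v i = 0 := fun i j v => by
      rcases eq_or_ne v 0 with rfl | hv
      · simp
      · exact eq_zero_of_sq_eq_quad_mul_sq hn hHs hH (hDwedge i j) (hwedge _ i j) (hsq i j) hv
    refine ⟨fun v i j => ?_, fun _ => ?_, fun h0 => absurd rfl h0⟩
    · have := hsq i j v
      rw [hb i j v] at this
      simpa using this
    · have hB : H⁻¹ * Θ = 0 := Matrix.eq_zero_of_forall_mulVec fun v =>
        inv_mul_mulVec_eq_zero_of_parallel hHs hH hΘ fun i j => hb i j v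
      rw [← hH.mul_inv_mul_cancel Θ, hB, Matrix.mul_zero]
  have hA0 : G⁻¹ * Ω ≠ 0 := fun h0 => hΩ0 (by rw [← hG.mul_inv_mul_cancel Ω, h0, Matrix.mul_zero])
  have hdense := dense_setOf_mulVec_ne_zero hA0
  have hgen : ∀ v, (G⁻¹ * Ω) *ᵥ v ≠ 0 → _ := fun v hv => (halt v).resolve_right fun h1 => hv h1.1
  have hD : ∀ v i j, D v i * v j - D v j * v i = 0 := fun v i j =>
    congrFun (Continuous.ext_on (f := fun v => D v i * v j - D v j * v i) (g := fun _ => 0) hdense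
      (by have := hDi i; have := hDi j; fun_prop) continuous_const
      fun v hv => (hgen v hv i j).1) v
  have hab : ∀ i j v, quad G v * (((G⁻¹ * Ω) *ᵥ v) i * v j - ((G⁻¹ * Ω) *ᵥ v) j * v i) ^ 2 =
      quad H v * (((H⁻¹ * Θ) *ᵥ v) i * v j - ((H⁻¹ * Θ) *ᵥ v) j * v i) ^ 2 := fun i j v =>
    congrFun (Continuous.ext_on
      (f := fun v => quad G v * (((G⁻¹ * Ω) *ᵥ v) i * v j - ((G⁻¹ * Ω) *ᵥ v) j * v i) ^ 2)
      (g := fun v => quad H v * (((H⁻¹ * Θ) *ᵥ v) i * v j - ((H⁻¹ * Θ) *ᵥ v) j * v i) ^ 2) hdense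
      (by
        have := hAi (G⁻¹ * Ω) i; have := hAi (G⁻¹ * Ω) j
        have := continuous_quad (G := G); fun_prop)
      (by
        have := hAi (H⁻¹ * Θ) i; have := hAi (H⁻¹ * Θ) j
        have := continuous_quad (G := H); fun_prop)
      fun v hv => (hgen v hv i j).2) v
  refine ⟨hD, fun h0 => absurd h0 hΩ0, fun _ => ?_⟩
  obtain ⟨u, hu⟩ : ∃ u, (G⁻¹ * Ω) *ᵥ u ≠ 0 := by
    by_contra! h0
    exact hA0 (Matrix.eq_zero_of_forall_mulVec h0)
  have hu0 : u ≠ 0 := by rintro rfl; simp at hu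
  obtain ⟨i, j, hij⟩ : ∃ i j, ((G⁻¹ * Ω) *ᵥ u) i * u j - ((G⁻¹ * Ω) *ᵥ u) j * u i ≠ 0 := by
    by_contra! h0
    exact hu (inv_mul_mulVec_eq_zero_of_parallel hGs hG hΩ h0)
  have hMu := quad_pos hH hu0
  have hprop := quad_proportional_of_mul_sq_eq hGs hG hHs hH (hwedge _ i j) (hwedge _ i j)
    (hab i j) hij hu0
  set κ := quad G u / quad H u with hκ
  have hκpos : 0 < κ := div_pos (quad_pos hG hu0) hMu
  have hGH : G = κ • H := by
    rw [← sub_eq_zero]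
    refine eq_zero_of_quad_eq_zero (by rw [Matrix.IsSymm, transpose_sub, transpose_smul,
      hGs.eq, hHs.eq]) fun v => ?_
    rw [quad_sub_matrix, quad_smul_matrix, hκ]
    field_simp
    linarith [hprop v]
  have hs := Real.sqrt_pos.mpr hκpos
  have hs2 := Real.mul_self_sqrt hκpos.le
  refine ⟨κ, hκpos, hGH, ?_⟩
  have hmul : ∀ C : Matrix (Fin n) (Fin n) ℝ, √κ • (√κ • C) = κ • C := fun C => by
    rw [smul_smul, hs2]
  have hcases : √κ • (G⁻¹ * Ω) = H⁻¹ * Θ ∨ √κ • (G⁻¹ * Ω) = -(H⁻¹ * Θ) := by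
    refine eq_or_eq_neg_of_forall_mulVec (smul_ne_zero hs.ne' hA0) fun v hv => ?_
    have hv0 : v ≠ 0 := by rintro rfl; simp at hv
    have hAv : (G⁻¹ * Ω) *ᵥ v ≠ 0 := fun h0 => hv (by rw [smul_mulVec, h0, smul_zero])
    obtain ⟨ε, hε, r, hr⟩ := h v hv0
    have hNv := quad_pos hG hv0
    have hMv := quad_pos hH hv0
    have hsq : √(quad G v) = √κ * √(quad H v) := by
      rw [hGH, quad_smul_matrix, Real.sqrt_mul hκpos.le]
    obtain ⟨q, hq⟩ : ∃ q : ℝ, D v = q • v := by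
      obtain ⟨k, hk⟩ := Function.ne_iff.mp hv0
      refine ⟨D v k / v k, funext fun i => ?_⟩
      have := hD v i k
      have hk' : v k ≠ 0 := hk
      simp only [Pi.smul_apply, smul_eq_mul]
      field_simp
      linarith
    have hlin : (ε * √(quad H v)) • ((H⁻¹ * Θ) *ᵥ v) - √(quad G v) • ((G⁻¹ * Ω) *ᵥ v) =
        (r - q) • v := by
      rw [sub_smul, ← hr, hq]; abel
    have hHB : v ⬝ᵥ G *ᵥ (H⁻¹ * Θ) *ᵥ v = 0 := by
      rw [hGH, smul_mulVec, dotProduct_smul, dotProduct_mulVec_inv_mul_of_skew hH hΘ, smul_zero]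
    have hrq : r - q = 0 := by
      have h6 := congrArg (fun w => v ⬝ᵥ G *ᵥ w) hlin
      simp only [mulVec_sub, mulVec_smul, dotProduct_sub, dotProduct_smul, hHB,
        dotProduct_mulVec_inv_mul_of_skew hG hΩ, smul_eq_mul, mul_zero, sub_zero] at h6
      rw [← quad_eq_dotProduct] at h6
      exact (mul_eq_zero.mp h6.symm).resolve_right hNv.ne'
    rw [hrq, zero_smul, sub_eq_zero, hsq] at hlin
    have hb := (Real.sqrt_pos.mpr hMv).ne'
    have hlin2 : (√κ • (G⁻¹ * Ω)) *ᵥ v = ε • ((H⁻¹ * Θ) *ᵥ v) := by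
      rw [smul_mulVec]
      funext i
      have := congrFun hlin i
      simp only [Pi.smul_apply, smul_eq_mul] at this ⊢
      apply mul_left_cancel₀ hb
      linarith
    rcases hε with rfl | rfl
    · left; rw [hlin2, one_smul]
    · right; rw [hlin2, neg_smul, one_smul]
  have key : ∀ C, √κ • (G⁻¹ * Ω) = C → Ω = √κ • (H * C) := fun C hC => by
    rw [← hC, ← hG.mul_inv_mul_cancel Ω, Matrix.mul_smul, hmul]
    conv_lhs => rw [hGH]
    rw [hG.mul_inv_mul_cancel, Matrix.smul_mul, ← hGH]
  rcases hcases with h1 | h1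
  · left; rw [key _ h1, hH.mul_inv_mul_cancel]
  · right; rw [key _ h1, Matrix.mul_neg, hH.mul_inv_mul_cancel, smul_neg]

end pointwise

section christoffel

variable {n : ℕ} {G H : Matrix (Fin n) (Fin n) ℝ} {T S : Fin n → Matrix (Fin n) (Fin n) ℝ}

/-- The quadratic map `v ↦ (∑ k p, D j k p * v k * v p)_j` of an array of coefficients. -/
def arrayQuad (D : Fin n → Fin n → Fin n → ℝ) (v : Fin n → ℝ) : Fin n → ℝ :=
  fun j => ∑ k, ∑ p, D j k p * v k * v p

/-- The Christoffel symbols of a metric with value `G` and partial derivatives `T k`. -/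
noncomputable def christoffel (G : Matrix (Fin n) (Fin n) ℝ)
    (T : Fin n → Matrix (Fin n) (Fin n) ℝ) : Fin n → Fin n → Fin n → ℝ :=
  fun j k p => ∑ i, G⁻¹ j i * ((T k i p + T p i k - T i k p) / 2)

theorem arrayQuad_neg (D : Fin n → Fin n → Fin n → ℝ) (v : Fin n → ℝ) :
    arrayQuad D (-v) = arrayQuad D v := by
  funext j
  simp [arrayQuad]

theorem arrayQuad_sub (D E : Fin n → Fin n → Fin n → ℝ) (v : Fin n → ℝ) :
    arrayQuad (D - E) v = arrayQuad D v - arrayQuad E v := by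
  funext j
  simp [arrayQuad, sub_mul, Finset.sum_sub_distrib]

theorem polyOnLines_arrayQuad (D : Fin n → Fin n → Fin n → ℝ) (j : Fin n) :
    PolyOnLines 2 (fun v => arrayQuad D v j) := by
  have h := PolyOnLines.sum (n := n) (d := 2) fun k => PolyOnLines.sum (n := n) (d := 2) fun p =>
    ((PolyOnLines.coord k).mul (PolyOnLines.coord p)).const_mul (D j k p)
  simpa only [arrayQuad, mul_assoc] using h

theorem continuous_arrayQuad (D : Fin n → Fin n → Fin n → ℝ) : Continuous (arrayQuad D) := by
  unfold arrayQuad; fun_prop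

theorem arrayQuad_add_single {D : Fin n → Fin n → Fin n → ℝ} (hD : ∀ j k p, D j k p = D j p k)
    (v : Fin n → ℝ) (m : Fin n) (s : ℝ) (j : Fin n) :
    arrayQuad D (v + s • Pi.single m 1) j =
      arrayQuad D v j + 2 * s * (∑ p, D j m p * v p) + s ^ 2 * D j m m := by
  have h1 : ∀ k p, D j k p * (v k + s * (Pi.single m 1 : Fin n → ℝ) k) *
      (v p + s * (Pi.single m 1 : Fin n → ℝ) p) = D j k p * v k * v p +
      s * (D j k p * v k * (Pi.single m 1 : Fin n → ℝ) p) +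
      s * (D j k p * v p * (Pi.single m 1 : Fin n → ℝ) k) +
      s ^ 2 * (D j k p * (Pi.single m 1 : Fin n → ℝ) k * (Pi.single m 1 : Fin n → ℝ) p) :=
    fun k p => by ring
  simp only [arrayQuad, Pi.add_apply, Pi.smul_apply, smul_eq_mul, h1, Finset.sum_add_distrib,
    ← Finset.mul_sum]
  have h2 : ∑ k, ∑ p, D j k p * v k * (Pi.single m 1 : Fin n → ℝ) p = ∑ p, D j m p * v p := by
    simp [Pi.single_apply, hD j m]
  have h3 : ∑ k, ∑ p, D j k p * v p * (Pi.single m 1 : Fin n → ℝ) k = ∑ p, D j m p * v p := by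
    rw [Finset.sum_comm]; simp [Pi.single_apply]
  have h4 : ∑ k, ∑ p, D j k p * (Pi.single m 1 : Fin n → ℝ) k *
      (Pi.single m 1 : Fin n → ℝ) p = D j m m := by
    simp [Pi.single_apply]
  rw [h2, h3, h4]; ring

theorem arrayQuad_eq_trace_of_parallel {D : Fin n → Fin n → Fin n → ℝ}
    (hD : ∀ j k p, D j k p = D j p k)
    (h : ∀ v i j, arrayQuad D v i * v j - arrayQuad D v j * v i = 0) (v : Fin n → ℝ) (j : Fin n) :
    ((n : ℝ) + 1) * arrayQuad D v j = 2 * (∑ p, (∑ i, D i i p) * v p) * v j := by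
  have key : ∀ i, 2 * (∑ p, D i i p * v p) * v j + arrayQuad D v i * (Pi.single i 1 : Fin n → ℝ) j
      = 2 * (∑ p, D j i p * v p) * v i + arrayQuad D v j := fun i => by
    have h1 := h (v + (1 : ℝ) • Pi.single i 1) i j
    have h2 := h (v + (-1 : ℝ) • Pi.single i 1) i j
    have h3 := h (0 + (1 : ℝ) • Pi.single i 1) i j
    simp only [arrayQuad_add_single hD, Pi.add_apply, Pi.smul_apply, smul_eq_mul,
      Pi.single_eq_same] at h1 h2 h3
    have h0 : ∀ j, arrayQuad D 0 j = 0 := fun j => by simp [arrayQuad]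
    simp only [h0, Pi.zero_apply, mul_zero, Finset.sum_const_zero] at h3
    linear_combination (h1 - h2) / 2 - h3
  have hsum := Finset.sum_congr rfl fun i (_ : i ∈ Finset.univ) => key i
  rw [Finset.sum_add_distrib, Finset.sum_add_distrib] at hsum
  have e1 : ∑ i, 2 * (∑ p, D i i p * v p) * v j = 2 * (∑ p, (∑ i, D i i p) * v p) * v j := by
    rw [← Finset.sum_mul, ← Finset.mul_sum, Finset.sum_comm]
    simp only [Finset.sum_mul]
  have e2 : ∑ i, arrayQuad D v i * (Pi.single i 1 : Fin n → ℝ) j = arrayQuad D v j := by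
    simp [Pi.single_apply]
  have e3 : ∑ i, 2 * (∑ p, D j i p * v p) * v i = 2 * arrayQuad D v j := by
    simp only [arrayQuad, Finset.mul_sum, Finset.sum_mul]
    exact Finset.sum_congr rfl fun k _ => Finset.sum_congr rfl fun p _ => by ring
  rw [e1, e2, e3] at hsum
  simp only [Finset.sum_const, Finset.card_univ, Fintype.card_fin, nsmul_eq_mul] at hsum
  linarith

theorem christoffel_symm (hT : ∀ k, (T k).IsSymm) (j k p : Fin n) :
    christoffel G T j k p = christoffel G T j p k := by
  refine Finset.sum_congr rfl fun i _ => ?_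
  rw [(hT i).apply k p]; ring

theorem trace_christoffel (hG : G.IsSymm) (p : Fin n) :
    ∑ i, christoffel G T i i p = (G⁻¹ * T p).trace / 2 := by
  have hGi : ∀ i j, G⁻¹ i j = G⁻¹ j i := fun i j => by
    have h := Matrix.transpose_nonsing_inv G
    rw [hG.eq] at h
    conv_lhs => rw [← h, Matrix.transpose_apply]
  have h1 : ∑ j, ∑ i, G⁻¹ j i * T j i p = ∑ j, ∑ i, G⁻¹ j i * T i j p := by
    rw [Finset.sum_comm]
    exact Finset.sum_congr rfl fun i _ => Finset.sum_congr rfl fun j _ => by rw [hGi]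
  have h2 : ∑ i, christoffel G T i i p = (∑ j, ∑ i, G⁻¹ j i * T j i p +
      ∑ j, ∑ i, G⁻¹ j i * T p i j - ∑ j, ∑ i, G⁻¹ j i * T i j p) / 2 := by
    simp only [christoffel, ← Finset.sum_add_distrib, ← Finset.sum_sub_distrib, Finset.sum_div]
    exact Finset.sum_congr rfl fun i _ => Finset.sum_congr rfl fun j _ => by ring
  rw [h2, h1]
  simp [Matrix.trace, Matrix.mul_apply]

theorem arrayQuad_christoffel (v : Fin n → ℝ) (j : Fin n) :
    arrayQuad (christoffel G T) v j =
      ∑ i, ∑ k, ∑ p, G⁻¹ j i * T k i p * v k * v p -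
        1 / 2 * ∑ i, ∑ p, ∑ q, G⁻¹ j i * T i p q * v p * v q := by
  have h1 : ∀ i, ∑ k, ∑ p, G⁻¹ j i * T k i p * v k * v p =
      ∑ k, ∑ p, G⁻¹ j i * T p i k * v k * v p := fun i => by
    rw [Finset.sum_comm]
    exact Finset.sum_congr rfl fun k _ => Finset.sum_congr rfl fun p _ => by ring
  have h2 : arrayQuad (christoffel G T) v j = ∑ i, ∑ k, ∑ p,
      (G⁻¹ j i * T k i p * v k * v p / 2 + G⁻¹ j i * T p i k * v k * v p / 2 -
        G⁻¹ j i * T i k p * v k * v p / 2) := by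
    simp only [arrayQuad, christoffel, Finset.sum_mul]
    rw [Finset.sum_comm]
    refine (Finset.sum_congr rfl fun p _ => Finset.sum_comm).trans ?_
    rw [Finset.sum_comm]
    refine Finset.sum_congr rfl fun i _ => ?_
    rw [Finset.sum_comm]
    exact Finset.sum_congr rfl fun k _ => Finset.sum_congr rfl fun p _ => by ring
  rw [h2]
  simp only [Finset.sum_add_distrib, Finset.sum_sub_distrib, ← Finset.sum_div, ← h1]
  ring

theorem dotProduct_mulVec_arrayQuad_christoffel (hG : G.PosDef) (v : Fin n → ℝ) :
    v ⬝ᵥ G *ᵥ arrayQuad (christoffel G T) v = (∑ k, v k * quad (T k) v) / 2 := by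
  set L : Fin n → ℝ := fun i => ∑ k, ∑ p, T k i p * v k * v p -
    1 / 2 * ∑ p, ∑ q, T i p q * v p * v q with hL
  have h1 : arrayQuad (christoffel G T) v = G⁻¹ *ᵥ L := by
    funext j
    rw [arrayQuad_christoffel]
    simp only [Matrix.mulVec, dotProduct, hL, mul_sub, Finset.sum_sub_distrib, Finset.mul_sum]
    congr 1
    · simp only [mul_assoc]
    · refine Finset.sum_congr rfl fun i _ => Finset.sum_congr rfl fun p _ =>
        Finset.sum_congr rfl fun q _ => by ring
  rw [h1, Matrix.mulVec_mulVec, Matrix.mul_nonsing_inv _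
    ((Matrix.isUnit_iff_isUnit_det _).mp hG.isUnit), Matrix.one_mulVec]
  have h2 : ∑ i, ∑ k, ∑ p, v i * (T k i p * v k * v p) =
      ∑ k, ∑ i, ∑ p, v k * (T k i p * v i * v p) := by
    rw [Finset.sum_comm]
    exact Finset.sum_congr rfl fun k _ => Finset.sum_congr rfl fun i _ =>
      Finset.sum_congr rfl fun p _ => by ring
  simp only [dotProduct, hL, quad, mul_sub, Finset.sum_sub_distrib, Finset.mul_sum, h2,
    Finset.sum_div]
  simp only [← Finset.sum_sub_distrib]
  exact Finset.sum_congr rfl fun k _ => Finset.sum_congr rfl fun i _ =>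
      Finset.sum_congr rfl fun p _ => by ring

/-- The infinitesimal Painlevé integral: if two metrics have the same unparametrized geodesics,
then `(det g / det ḡ) ^ (2 / (n + 1)) * ḡ` satisfies the Killing equation of `g`. -/
theorem killing_of_parallel (hG : G.IsSymm) (hH : H.IsSymm) (hH' : H.PosDef)
    (hT : ∀ k, (T k).IsSymm) (hS : ∀ k, (S k).IsSymm)
    (h : ∀ v i j, arrayQuad (christoffel H S - christoffel G T) v i * v j -
      arrayQuad (christoffel H S - christoffel G T) v j * v i = 0)
    {l : ℝ} {dl : Fin n → ℝ}
    (hdl : ∀ k, dl k = l * (2 / ((n : ℝ) + 1) * ((G⁻¹ * T k).trace - (H⁻¹ * S k).trace)))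
    (v : Fin n → ℝ) :
    ∑ k, v k * (dl k * quad H v + l * quad (S k) v) -
      2 * (l * (v ⬝ᵥ H *ᵥ arrayQuad (christoffel G T) v)) = 0 := by
  have hn : (n : ℝ) + 1 ≠ 0 := by positivity
  set D := christoffel H S - christoffel G T with hD
  have hDs : ∀ j k p, D j k p = D j p k := fun j k p => by
    simp [hD, christoffel_symm hS j k p, christoffel_symm hT j k p]
  set τ := ∑ p, (∑ i, D i i p) * v p with hτ
  have hτ' : τ = -∑ p, v p * (((G⁻¹ * T p).trace - (H⁻¹ * S p).trace) / 2) := by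
    rw [hτ, ← Finset.sum_neg_distrib]
    refine Finset.sum_congr rfl fun p _ => ?_
    simp only [hD, Pi.sub_apply, Finset.sum_sub_distrib, trace_christoffel hH, trace_christoffel hG]
    ring
  have hpar : arrayQuad D v = (2 * τ / ((n : ℝ) + 1)) • v := by
    funext j
    have := arrayQuad_eq_trace_of_parallel hDs h v j
    simp only [Pi.smul_apply, smul_eq_mul]
    field_simp
    linarith
  have h1 : arrayQuad (christoffel G T) v =
      arrayQuad (christoffel H S) v - (2 * τ / ((n : ℝ) + 1)) • v := by
    rw [← hpar, hD, arrayQuad_sub]; abel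
  rw [h1, mulVec_sub, mulVec_smul, dotProduct_sub, dotProduct_smul,
    dotProduct_mulVec_arrayQuad_christoffel hH', ← quad_eq_dotProduct]
  have h2 : ∑ k, v k * (dl k * quad H v + l * quad (S k) v) =
      -(4 / ((n : ℝ) + 1)) * l * τ * quad H v + l * ∑ k, v k * quad (S k) v := by
    rw [hτ', Finset.mul_sum, ← Finset.sum_neg_distrib, Finset.mul_sum, Finset.sum_mul,
      ← Finset.sum_add_distrib]
    refine Finset.sum_congr rfl fun k _ => ?_
    rw [hdl]; ring
  rw [h2, smul_eq_mul]
  field_simp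
  ring

end christoffel

section calculus

variable {n : ℕ}

/-- The matrix of partial derivatives `∂g_{ij}/∂x^k` of a matrix field at `p`. -/
noncomputable def gder (g : (Fin n → ℝ) → Matrix (Fin n) (Fin n) ℝ) (p : Fin n → ℝ)
    (k : Fin n) : Matrix (Fin n) (Fin n) ℝ :=
  Matrix.of fun i j => dpart (fun q => g q i j) k p

theorem fderiv_apply_eq_sum_dpart (f : (Fin n → ℝ) → ℝ) (p v : Fin n → ℝ) :
    fderiv ℝ f p v = ∑ k, v k * dpart f k p := by
  conv_lhs => rw [pi_eq_sum_univ' v]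
  simp [dpart]

theorem contDiffAt_dpart {U : Set (Fin n → ℝ)} (hU : IsOpen U) {f : (Fin n → ℝ) → ℝ}
    (hf : ContDiffOn ℝ 2 f U) {p : Fin n → ℝ} (hp : p ∈ U) (k : Fin n) :
    ContDiffAt ℝ 1 (dpart f k) p :=
  ((hf.contDiffAt (hU.mem_nhds hp)).fderiv_right (m := 1) (by norm_num)).clm_apply
    contDiffAt_const

theorem gder_isSymm {U : Set (Fin n → ℝ)} (hU : IsOpen U)
    {g : (Fin n → ℝ) → Matrix (Fin n) (Fin n) ℝ} (hg : ∀ p ∈ U, (g p).IsSymm)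
    {p : Fin n → ℝ} (hp : p ∈ U) (k : Fin n) : (gder g p k).IsSymm := by
  ext i j
  simp only [transpose_apply, gder, of_apply, dpart]
  rw [Filter.EventuallyEq.fderiv_eq]
  filter_upwards [hU.mem_nhds hp] with q hq
  exact (hg q hq).apply i j

theorem contDiffAt_det {E : Type*} [NormedAddCommGroup E] [NormedSpace ℝ E] {m : WithTop ℕ∞}
    {M : E → Matrix (Fin n) (Fin n) ℝ} {z : E} (hM : ∀ i j, ContDiffAt ℝ m (fun y => M y i j) z) :
    ContDiffAt ℝ m (fun y => (M y).det) z := by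
  simp only [Matrix.det_apply']
  exact ContDiffAt.sum fun σ _ => contDiffAt_const.mul (contDiffAt_prod fun i _ => hM _ _)

theorem contDiffAt_inv_entry {E : Type*} [NormedAddCommGroup E] [NormedSpace ℝ E]
    {m : WithTop ℕ∞} {M : E → Matrix (Fin n) (Fin n) ℝ} {z : E}
    (hM : ∀ i j, ContDiffAt ℝ m (fun y => M y i j) z) (hz : (M z).det ≠ 0) (i j : Fin n) :
    ContDiffAt ℝ m (fun y => (M y)⁻¹ i j) z := by
  simp only [Matrix.inv_def, Ring.inverse_eq_inv', Matrix.smul_apply, smul_eq_mul,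
    Matrix.adjugate_apply]
  refine ((contDiffAt_det hM).inv hz).mul (contDiffAt_det fun a b => ?_)
  by_cases ha : a = j
  · simp only [ha, Matrix.updateRow_self]
    exact contDiffAt_const
  · simp only [Matrix.updateRow_ne ha]
    exact hM a b

theorem hasFDerivAt_det (M : Matrix (Fin n) (Fin n) ℝ) :
    ∃ L : (Fin n → Fin n → ℝ) →L[ℝ] ℝ,
      HasFDerivAt (fun A : Fin n → Fin n → ℝ => Matrix.det (Matrix.of A)) L
        (fun i j => M i j) ∧ ∀ Y, L Y = (M.adjugate * Matrix.of Y).trace := by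
  let f : ContinuousMultilinearMap ℝ (fun _ : Fin n => Fin n → ℝ) ℝ :=
    { toMultilinearMap := (Matrix.detRowAlternating (R := ℝ) (n := Fin n)).toMultilinearMap
      cont := Continuous.matrix_det continuous_id }
  refine ⟨f.linearDeriv fun i j => M i j, f.hasFDerivAt _, fun Y => ?_⟩
  rw [ContinuousMultilinearMap.linearDeriv_apply]
  have h1 : ∀ i, f (Function.update (fun i j => M i j) i (Y i)) = (M.updateRow i (Y i)).det :=
    fun i => rfl
  simp only [h1, ← Matrix.cramer_transpose_apply, Matrix.cramer_eq_adjugate_mulVec,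
    ← Matrix.adjugate_transpose]
  rw [Matrix.trace_mul_comm]
  simp [Matrix.mulVec, dotProduct, Matrix.trace, Matrix.mul_apply, mul_comm]

theorem dpart_log_det {g : (Fin n → ℝ) → Matrix (Fin n) (Fin n) ℝ} {p : Fin n → ℝ}
    (hg : ∀ i j, DifferentiableAt ℝ (fun q => g q i j) p) (hp : 0 < (g p).det) (k : Fin n) :
    dpart (fun q => Real.log (g q).det) k p = ((g p)⁻¹ * gder g p k).trace := by
  obtain ⟨L, hL, hLY⟩ := hasFDerivAt_det (g p)
  have h1 : HasFDerivAt (fun q => (fun i j => g q i j : Fin n → Fin n → ℝ))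
      (ContinuousLinearMap.pi fun i => ContinuousLinearMap.pi fun j =>
        fderiv ℝ (fun q => g q i j) p) p :=
    hasFDerivAt_pi.mpr fun i => hasFDerivAt_pi.mpr fun j => (hg i j).hasFDerivAt
  have h2 : HasFDerivAt (fun q => (g q).det) _ p :=
    HasFDerivAt.comp (g := fun A : Fin n → Fin n → ℝ => Matrix.det (Matrix.of A))
      (f := fun q => (fun i j => g q i j : Fin n → Fin n → ℝ)) p hL h1
  rw [dpart, (h2.log hp.ne').fderiv]
  have h3 : ((g p)⁻¹ * gder g p k) = (g p).det⁻¹ • ((g p).adjugate * gder g p k) := by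
    rw [Matrix.inv_def, Ring.inverse_eq_inv', Matrix.smul_mul]
  rw [h3, Matrix.trace_smul]
  simp only [_root_.smul_apply, ContinuousLinearMap.comp_apply, hLY]
  rfl

theorem hasDerivAt_quad_curve {K : (Fin n → ℝ) → Matrix (Fin n) (Fin n) ℝ}
    {x v : ℝ → Fin n → ℝ} {a : Fin n → ℝ} {t : ℝ}
    (hK : ∀ i j, DifferentiableAt ℝ (fun q => K q i j) (x t)) (hKs : (K (x t)).IsSymm)
    (hx : HasDerivAt x (v t) t) (hv : HasDerivAt v a t) :
    HasDerivAt (fun s => quad (K (x s)) (v s))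
      (∑ k, v t k * quad (gder K (x t) k) (v t) + 2 * (v t ⬝ᵥ K (x t) *ᵥ a)) t := by
  have h1 : ∀ i j, HasDerivAt (fun s => K (x s) i j)
      (∑ k, v t k * gder K (x t) k i j) t := fun i j => by
    have := (hK i j).hasFDerivAt.comp_hasDerivAt t hx
    rw [fderiv_apply_eq_sum_dpart] at this
    exact this
  have hvi := hasDerivAt_pi.mp hv
  have h2 := HasDerivAt.fun_sum (u := Finset.univ) fun i _ => HasDerivAt.fun_sum
    (u := Finset.univ) fun j (_ : j ∈ Finset.univ) => ((h1 i j).mul (hvi i)).mul (hvi j)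
  refine h2.congr_deriv ?_
  have e2 : v t ⬝ᵥ K (x t) *ᵥ a = ∑ i, ∑ j, K (x t) i j * a i * v t j := by
    rw [hKs.dotProduct_mulVec_comm]
    simp only [dotProduct, Matrix.mulVec, Finset.mul_sum]
    exact Finset.sum_congr rfl fun i _ => Finset.sum_congr rfl fun j _ => by ring
  have e3 : v t ⬝ᵥ K (x t) *ᵥ a = ∑ i, ∑ j, K (x t) i j * v t i * a j := by
    simp only [dotProduct, Matrix.mulVec, Finset.mul_sum]
    exact Finset.sum_congr rfl fun i _ => Finset.sum_congr rfl fun j _ => by ring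
  have e1 : ∑ k, v t k * quad (gder K (x t) k) (v t) =
      ∑ i, ∑ j, (∑ k, v t k * gder K (x t) k i j) * v t i * v t j := by
    simp only [quad, Finset.mul_sum, Finset.sum_mul]
    rw [Finset.sum_comm]
    refine Finset.sum_congr rfl fun i _ => ?_
    rw [Finset.sum_comm]
    exact Finset.sum_congr rfl fun j _ => Finset.sum_congr rfl fun k _ => by ring
  rw [two_mul]
  nth_rewrite 1 [e2]
  rw [e3, e1]
  simp only [← Finset.sum_add_distrib]
  exact Finset.sum_congr rfl fun i _ => Finset.sum_congr rfl fun j _ => by simp; ring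

/-- The first-order system of the curves `ẍ = -Γ(ẋ, ẋ) - |ẋ| B ẋ`. -/
noncomputable def geodField (g B : (Fin n → ℝ) → Matrix (Fin n) (Fin n) ℝ) :
    (Fin n → ℝ) × (Fin n → ℝ) → (Fin n → ℝ) × (Fin n → ℝ) := fun z =>
  (z.2, -arrayQuad (christoffel (g z.1) (gder g z.1)) z.2 -
    √(quad (g z.1) z.2) • (B z.1 *ᵥ z.2))

theorem contDiffAt_geodField {U : Set (Fin n → ℝ)} (hU : IsOpen U)
    {g B : (Fin n → ℝ) → Matrix (Fin n) (Fin n) ℝ} (hpos : ∀ p ∈ U, (g p).PosDef)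
    (hg : ∀ i j, ContDiffOn ℝ 2 (fun q => g q i j) U) {p v : Fin n → ℝ} (hp : p ∈ U)
    (hv : v ≠ 0) (hB : ∀ i j, ContDiffAt ℝ 1 (fun q => B q i j) p) :
    ContDiffAt ℝ 1 (geodField g B) (p, v) := by
  have hfst : ∀ {f : (Fin n → ℝ) → ℝ}, ContDiffAt ℝ 1 f p →
      ContDiffAt ℝ 1 (fun z : (Fin n → ℝ) × (Fin n → ℝ) => f z.1) (p, v) := fun hf =>
    ContDiffAt.comp (p, v) (f := Prod.fst) hf contDiffAt_fst
  have hsnd : ∀ i, ContDiffAt ℝ 1 (fun z : (Fin n → ℝ) × (Fin n → ℝ) => z.2 i) (p, v) :=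
    fun i => contDiffAt_pi.mp contDiffAt_snd i
  have hgp : ∀ i j, ContDiffAt ℝ 1 (fun q => g q i j) p := fun i j =>
    ((hg i j).contDiffAt (hU.mem_nhds hp)).of_le (by norm_num)
  have hT : ∀ k i j, ContDiffAt ℝ 1 (fun q => gder g q k i j) p := fun k i j =>
    contDiffAt_dpart hU (hg i j) hp k
  have hinv := contDiffAt_inv_entry hgp (hpos p hp).det_pos.ne'
  have hchr : ∀ j k m, ContDiffAt ℝ 1 (fun q => christoffel (g q) (gder g q) j k m) p :=
    fun j k m => ContDiffAt.sum fun i _ => (hinv j i).mul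
      ((((hT k i m).add (hT m i k)).sub (hT i k m)).div_const 2)
  have hquad : ContDiffAt ℝ 1
      (fun z : (Fin n → ℝ) × (Fin n → ℝ) => quad (g z.1) z.2) (p, v) :=
    ContDiffAt.sum fun i _ => ContDiffAt.sum fun j _ =>
      ((hfst (hgp i j)).mul (hsnd i)).mul (hsnd j)
  have hBv : ∀ j, ContDiffAt ℝ 1
      (fun z : (Fin n → ℝ) × (Fin n → ℝ) => (B z.1 *ᵥ z.2) j) (p, v) := fun j => by
    simp only [Matrix.mulVec, dotProduct]
    exact ContDiffAt.sum fun k _ => (hfst (hB j k)).mul (hsnd k)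
  refine contDiffAt_snd.prodMk (contDiffAt_pi.mpr fun j => ContDiffAt.sub ?_ ?_)
  · exact ContDiffAt.neg (ContDiffAt.sum fun k _ => ContDiffAt.sum fun m _ =>
      ((hfst (hchr j k m)).mul (hsnd k)).mul (hsnd m))
  · exact (hquad.sqrt (quad_pos (hpos p hp) hv).ne').mul (hBv j)

theorem hasDerivAt_quad_of_solution {g B : (Fin n → ℝ) → Matrix (Fin n) (Fin n) ℝ}
    {α : ℝ → (Fin n → ℝ) × (Fin n → ℝ)} {t : ℝ} (hα : HasDerivAt α (geodField g B (α t)) t)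
    (hsymm : (g (α t).1).IsSymm) (hpos : (g (α t).1).PosDef)
    (hg : ∀ i j, DifferentiableAt ℝ (fun q => g q i j) (α t).1)
    (hB : (α t).2 ⬝ᵥ g (α t).1 *ᵥ B (α t).1 *ᵥ (α t).2 = 0) :
    HasDerivAt (fun s => quad (g (α s).1) (α s).2) 0 t := by
  have hx : HasDerivAt (fun s => (α s).1) (α t).2 t := hα.fst
  have hv : HasDerivAt (fun s => (α s).2) (geodField g B (α t)).2 t := hα.snd
  refine (hasDerivAt_quad_curve (K := g) hg hsymm hx hv).congr_deriv ?_
  simp only [geodField, mulVec_sub, mulVec_neg, mulVec_smul, dotProduct_sub, dotProduct_neg,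
    dotProduct_smul, hB, dotProduct_mulVec_arrayQuad_christoffel hpos, smul_eq_mul]
  ring

end calculus

section geodesics

variable {n : ℕ} {U : Set (Fin n → ℝ)} {g : (Fin n → ℝ) → Matrix (Fin n) (Fin n) ℝ}
  {ω : (Fin n → ℝ) → (Fin n → ℝ)} {I : Set ℝ} {x : ℝ → Fin n → ℝ}

theorem dform_transpose (ω : (Fin n → ℝ) → (Fin n → ℝ)) (p : Fin n → ℝ) :
    (dform ω p)ᵀ = -dform ω p := by
  ext i j
  simp [dform]

theorem dform_neg (ω : (Fin n → ℝ) → (Fin n → ℝ)) (p : Fin n → ℝ) :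
    dform (fun q => -ω q) p = -dform ω p := by
  ext i j
  have h : ∀ i j, dpart (fun q => -ω q i) j p = -dpart (fun q => ω q i) j p := fun i j => by
    rw [dpart, fderiv_fun_neg]; rfl
  simp only [dform, of_apply, Pi.neg_apply, Matrix.neg_apply, h]
  ring

theorem inv_mul_dform_mulVec (p v : Fin n → ℝ) (j : Fin n) :
    (((g p)⁻¹ * dform ω p) *ᵥ v) j = ∑ i, ∑ k, (g p)⁻¹ j i *
      (dpart (fun q => ω q i) k p - dpart (fun q => ω q k) i p) * v k := by
  rw [← mulVec_mulVec]
  simp only [mulVec, dotProduct, dform, of_apply, Finset.mul_sum, mul_assoc]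

theorem euler_lagrange_iff (p v a : Fin n → ℝ) (d : ℝ) (hN : 0 < quad (g p) v) (j : Fin n) :
    a j / √(quad (g p) v) + v j * d
      + (1 / √(quad (g p) v)) *
        ∑ i, ∑ k, ∑ m, (g p)⁻¹ j i * dpart (fun q => g q i m) k p * v k * v m
      + ∑ i, ∑ k, (g p)⁻¹ j i *
        (dpart (fun q => ω q i) k p - dpart (fun q => ω q k) i p) * v k
      - (1 / (2 * √(quad (g p) v))) *
        ∑ i, ∑ m, ∑ q, (g p)⁻¹ j i * dpart (fun r => g r m q) i p * v m * v q = 0 ↔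
    a j + arrayQuad (christoffel (g p) (gder g p)) v j
      + √(quad (g p) v) * (((g p)⁻¹ * dform ω p) *ᵥ v) j = (-(√(quad (g p) v) * d)) * v j := by
  rw [inv_mul_dform_mulVec, arrayQuad_christoffel]
  simp only [gder, of_apply]
  have hs : √(quad (g p) v) ≠ 0 := (Real.sqrt_pos.mpr hN).ne'
  generalize √(quad (g p) v) = s at *
  generalize (∑ i, ∑ k, ∑ m, (g p)⁻¹ j i * dpart (fun q => g q i m) k p * v k * v m) = A
  generalize (∑ i, ∑ m, ∑ q, (g p)⁻¹ j i * dpart (fun r => g r m q) i p * v m * v q) = B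
  generalize (∑ i, ∑ k, (g p)⁻¹ j i *
        (dpart (fun q => ω q i) k p - dpart (fun q => ω q k) i p) * v k) = C
  constructor
  · intro h
    field_simp at h
    linear_combination h / 2
  · intro h
    field_simp
    linear_combination 2 * h

theorem IsRandersGeodesic.exists_smul_eq (hx : IsRandersGeodesic U g ω I x)
    (hg : ∀ p ∈ U, (g p).PosDef) {t : ℝ} (ht : t ∈ I) :
    ∃ r : ℝ, deriv (deriv x) t + arrayQuad (christoffel (g (x t)) (gder g (x t))) (deriv x t) +
      √(quad (g (x t)) (deriv x t)) • (((g (x t))⁻¹ * dform ω (x t)) *ᵥ deriv x t) =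
        r • deriv x t := by
  obtain ⟨-, -, hU, -, hv, h⟩ := hx
  exact ⟨_, funext fun j => (euler_lagrange_iff (g := g) (ω := ω) (x t) (deriv x t) _ _
    (quad_pos (hg _ (hU t ht)) (hv t ht)) j).mp (h t ht j)⟩

theorem IsRandersDatum.contDiffAt_inv_mul_dform (hd : IsRandersDatum U g ω) (hU : IsOpen U)
    {p : Fin n → ℝ} (hp : p ∈ U) (i j : Fin n) :
    ContDiffAt ℝ 1 (fun q => ((g q)⁻¹ * dform ω q) i j) p := by
  simp only [Matrix.mul_apply]
  exact ContDiffAt.sum fun k _ => (contDiffAt_inv_entry (fun i j =>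
    ((hd.2.1 i j).contDiffAt (hU.mem_nhds hp)).of_le (by norm_num))
      (hd.1 p hp).2.det_pos.ne' i k).mul
    ((contDiffAt_dpart hU (hd.2.2 k) hp j).sub (contDiffAt_dpart hU (hd.2.2 j) hp k))

theorem isRandersGeodesic_of_solution (hUo : IsOpen U) (hd : IsRandersDatum U g ω)
    {α : ℝ → (Fin n → ℝ) × (Fin n → ℝ)} (hI : IsOpen I) (hI' : I.OrdConnected)
    (hα : ∀ t ∈ I, HasDerivAt α (geodField g (fun p => (g p)⁻¹ * dform ω p) (α t)) t)
    (hU : ∀ t ∈ I, (α t).1 ∈ U) (hv : ∀ t ∈ I, (α t).2 ≠ 0) :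
    IsRandersGeodesic U g ω I (fun t => (α t).1) ∧
      (∀ t ∈ I, deriv (fun t => (α t).1) t = (α t).2) ∧ ∀ t ∈ I,
      deriv (deriv fun t => (α t).1) t = (geodField g (fun p => (g p)⁻¹ * dform ω p) (α t)).2 := by
  set F := geodField g (fun p => (g p)⁻¹ * dform ω p) with hF
  have h1 : ∀ t ∈ I, HasDerivAt (fun t => (α t).1) (α t).2 t := fun t ht => (hα t ht).fst
  have h2 : ∀ t ∈ I, HasDerivAt (fun t => (α t).2) (F (α t)).2 t := fun t ht => (hα t ht).snd
  have d1 : ∀ t ∈ I, deriv (fun t => (α t).1) t = (α t).2 := fun t ht => (h1 t ht).deriv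
  have d1' : ∀ t ∈ I, deriv (fun t => (α t).1) =ᶠ[nhds t] fun t => (α t).2 := fun t ht =>
    Filter.eventually_of_mem (hI.mem_nhds ht) d1
  have d2 : ∀ t ∈ I, deriv (deriv fun t => (α t).1) t = (F (α t)).2 := fun t ht => by
    rw [(d1' t ht).deriv_eq, (h2 t ht).deriv]
  obtain ⟨hpos, hg, -⟩ := id hd
  have hFc : ContinuousOn (fun t => F (α t)) I := fun t ht => by
    have hc : ContinuousAt F (α t) := (contDiffAt_geodField hUo (fun p hp => (hpos p hp).2) hg
      (hU t ht) (hv t ht) (hd.contDiffAt_inv_mul_dform hUo (hU t ht))).continuousAt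
    exact (ContinuousAt.comp hc (hα t ht).continuousAt).continuousWithinAt
  have hN : ∀ t ∈ I, HasDerivAt (fun s => quad (g (α s).1) (α s).2) 0 t := fun t ht =>
    hasDerivAt_quad_of_solution (hα t ht) (hpos _ (hU t ht)).1 (hpos _ (hU t ht)).2
      (fun i j => ((hg i j).contDiffAt (hUo.mem_nhds (hU t ht))).differentiableAt (by norm_num))
      (dotProduct_mulVec_inv_mul_of_skew (hpos _ (hU t ht)).2 (dform_transpose _ _) _)
  refine ⟨⟨hI, hI', hU, ?_, fun t ht => by rw [d1 t ht]; exact hv t ht, fun t ht j => ?_⟩, d1, d2⟩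
  · have e2 : (2 : WithTop ℕ∞) = 1 + 1 := by norm_num
    have e1 : (1 : WithTop ℕ∞) = 0 + 1 := by norm_num
    rw [e2, contDiffOn_succ_iff_deriv_of_isOpen hI]
    refine ⟨fun t ht => (h1 t ht).differentiableAt.differentiableWithinAt, by simp, ?_⟩
    rw [e1, contDiffOn_succ_iff_deriv_of_isOpen hI]
    refine ⟨fun t ht => ((d1' t ht).symm.hasDerivAt_iff.mp
      (h2 t ht)).differentiableAt.differentiableWithinAt, by simp, ?_⟩
    rw [contDiffOn_zero]
    exact hFc.snd.congr d2
  · have hq := quad_pos (hpos _ (hU t ht)).2 (hv t ht)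
    have hd : deriv (fun s => 1 / √(quad (g (α s).1) (deriv (fun t => (α t).1) s))) t = 0 := by
      have h3 : (fun s => 1 / √(quad (g (α s).1) (deriv (fun t => (α t).1) s))) =ᶠ[nhds t]
          fun s => (√(quad (g (α s).1) (α s).2))⁻¹ := by
        filter_upwards [d1' t ht] with s hs
        rw [hs, one_div]
      rw [h3.deriv_eq]
      have h4 := ((hN t ht).sqrt hq.ne').inv (Real.sqrt_pos.mpr hq).ne'
      refine HasDerivAt.deriv (h4.congr_deriv ?_)
      simp
    have key := (euler_lagrange_iff (g := g) (ω := ω) (α t).1 (α t).2 (F (α t)).2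
      (deriv (fun s => 1 / √(quad (g (α s).1) (deriv (fun t => (α t).1) s))) t) hq j).mpr (by
      rw [hd]
      simp only [hF, geodField, Pi.sub_apply, Pi.neg_apply, Pi.smul_apply, smul_eq_mul]
      ring)
    simp only [d1 t ht, d2 t ht]
    exact key

end geodesics

section flow

variable {n : ℕ} {U : Set (Fin n → ℝ)} {g H : (Fin n → ℝ) → Matrix (Fin n) (Fin n) ℝ}

open Metric Filter Topology in
theorem ContDiffAt.exists_continuousOn_flow {E : Type*} [NormedAddCommGroup E] [NormedSpace ℝ E]
    [CompleteSpace E] {F : E → E} {z : E} (hF : ContDiffAt ℝ 1 F z) {O : Set E} (hO : O ∈ 𝓝 z) :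
    ∃ r > 0, ∃ ε > 0, ∃ α : E × ℝ → E, (∀ y ∈ closedBall z r, α (y, 0) = y ∧
      ∀ t ∈ Set.Icc (-ε) ε, HasDerivAt (fun s => α (y, s)) (F (α (y, t))) t ∧ α (y, t) ∈ O) ∧
      ContinuousOn α (closedBall z r ×ˢ Set.Icc (-ε) ε) := by
  obtain ⟨e, he, a, r, L, K, hr, hpl⟩ := IsPicardLindelof.of_contDiffAt_one hF
  obtain ⟨α, hα, hc⟩ := (hpl 0).exists_forall_mem_closedBall_eq_hasDerivWithinAt_continuousOn
  simp only [zero_sub, zero_add] at hα hc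
  have hr' : (0 : ℝ) < r := hr
  have hz : α (z, 0) = z := (hα z (mem_closedBall_self hr'.le)).1
  have hnhds : closedBall z (r : ℝ) ×ˢ Set.Icc (-e) e ∈ 𝓝 (z, (0 : ℝ)) :=
    prod_mem_nhds (closedBall_mem_nhds z hr') (Icc_mem_nhds (by linarith) he)
  have hO' : α ⁻¹' O ∈ 𝓝 (z, (0 : ℝ)) :=
    (hc.continuousAt hnhds).preimage_mem_nhds (by rwa [hz])
  obtain ⟨δ, hδ, hball⟩ := Metric.mem_nhds_iff.mp hO'
  have hδ2 : 0 < min δ e / 2 := by positivity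
  have hδe : min δ e / 2 < e := by linarith [min_le_right δ e]
  have hδδ : min δ e / 2 < δ := by linarith [min_le_left δ e]
  refine ⟨min (r : ℝ) (δ / 2), by positivity, min δ e / 2, hδ2, α, fun y hy => ?_, ?_⟩
  · have hyr : y ∈ closedBall z r := closedBall_subset_closedBall (min_le_left _ _) hy
    refine ⟨(hα y hyr).1, fun t ht => ⟨?_, hball ?_⟩⟩
    · exact ((hα y hyr).2 t ⟨by linarith [ht.1], by linarith [ht.2]⟩).hasDerivAt
        (Icc_mem_nhds (by linarith [ht.1]) (by linarith [ht.2]))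
    · rw [mem_ball, Prod.dist_eq]
      refine max_lt ?_ ?_
      · have := (mem_closedBall.mp hy).trans (min_le_right _ _)
        change Dist.dist y z < δ
        linarith
      · change Dist.dist t 0 < δ
        rw [Real.dist_eq, sub_zero]
        exact (abs_le.mpr ht).trans_lt hδδ
  · exact hc.mono (Set.prod_mono (closedBall_subset_closedBall (min_le_left _ _))
      (Set.Icc_subset_Icc (by linarith) hδe.le))

open Filter Topology in
theorem eq_zero_of_eventually_quad_eq_zero {G : Matrix (Fin n) (Fin n) ℝ} (hG : G.IsSymm)
    {u : Fin n → ℝ} (h : ∀ᶠ v in 𝓝 u, quad G v = 0) : G = 0 := by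
  refine eq_zero_of_quad_eq_zero hG fun w => ?_
  have hc : Tendsto (fun t : ℝ => u + t • w) (𝓝 0) (𝓝 u) := by
    have : Continuous fun t : ℝ => u + t • w := by fun_prop
    simpa using this.tendsto 0
  obtain ⟨δ, hδ, hball⟩ := Metric.eventually_nhds_iff.mp (hc.eventually h)
  have h1 : ∀ t : ℝ, |t| < δ → quad G w * t ^ 2 + 2 * (u ⬝ᵥ G *ᵥ w) * t + quad G u = 0 :=
    fun t ht => by
      rw [← quad_add_smul hG]
      exact hball (by rwa [Real.dist_eq, sub_zero])
  have h2 := h1 (δ / 2) (by rw [abs_of_pos (by positivity)]; linarith)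
  have h3 := h1 (-(δ / 2)) (by rw [abs_neg, abs_of_pos (by positivity)]; linarith)
  have h4 := h1 0 (by simpa using hδ)
  have h5 : quad G w * (δ / 2) ^ 2 = 0 := by linear_combination (h2 + h3) / 2 - h4
  exact (mul_eq_zero.mp h5).resolve_right (by positivity)

/-- At the point `p`, the quadratic form `H` satisfies the condition making it constant along
the affinely parametrized geodesics of the metric `g`. -/
def IsQuadraticIntegral (g H : (Fin n → ℝ) → Matrix (Fin n) (Fin n) ℝ) (p : Fin n → ℝ) : Prop :=
  ∀ v, ∑ k, v k * quad (gder H p k) v =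
    2 * (v ⬝ᵥ H p *ᵥ arrayQuad (christoffel (g p) (gder g p)) v)

open Metric Filter Topology in
theorem eventually_eq_zero_of_ball (hUo : IsOpen U) (hpos : ∀ p ∈ U, (g p).PosDef)
    (hg : ∀ i j, ContDiffOn ℝ 2 (fun q => g q i j) U) (hHs : ∀ p ∈ U, (H p).IsSymm)
    (hH : ∀ p ∈ U, ∀ i j, DifferentiableAt ℝ (fun q => H q i j) p)
    (hkill : ∀ p ∈ U, IsQuadraticIntegral g H p) {y v : Fin n → ℝ} (hy : y ∈ U) (hv : v ≠ 0)
    (hball : ∀ p ∈ ball (y + v) ‖v‖, H p = 0) : ∀ᶠ p in 𝓝 y, H p = 0 := by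
  set F := geodField g 0 with hF
  have hFc : ContDiffAt ℝ 1 F (y, v) :=
    contDiffAt_geodField hUo hpos hg hy hv fun i j => contDiffAt_const
  have hO : U ×ˢ {w : Fin n → ℝ | w ≠ 0} ∈ 𝓝 (y, v) :=
    prod_mem_nhds (hUo.mem_nhds hy) (isOpen_ne.mem_nhds hv)
  obtain ⟨r, hr, ε, hε, α, hα, hc⟩ := hFc.exists_continuousOn_flow hO
  have hz := hα (y, v) (mem_closedBall_self hr.le)
  have hx : HasDerivAt (fun t => (α ((y, v), t)).1) v 0 := by
    have h1 : HasDerivAt (fun t => (α ((y, v), t)).1) _ 0 :=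
      (hz.2 0 ⟨by linarith, hε.le⟩).1.fst
    rwa [hz.1] at h1
  have hlo := hx.isLittleO
  have hnv : 0 < ‖v‖ := norm_pos_iff.mpr hv
  have hev := hlo.def (c := ‖v‖ / 2) (by positivity)
  obtain ⟨δ, hδ, hδ'⟩ := Metric.eventually_nhds_iff.mp hev
  set τ := min (δ / 2) (min ε 1) with hτ
  have hτ0 : 0 < τ := by positivity
  have hτδ : τ < δ := (min_le_left _ _).trans_lt (by linarith)
  have hτε : τ ≤ ε := (min_le_right _ _).trans (min_le_left _ _)
  have hτ1 : τ ≤ 1 := (min_le_right _ _).trans (min_le_right _ _)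
  have hτx : (α ((y, v), τ)).1 ∈ ball (y + v) ‖v‖ := by
    have h1 := @hδ' τ (by rwa [Real.dist_eq, sub_zero, abs_of_pos hτ0])
    rw [hz.1, sub_zero, Real.norm_of_nonneg hτ0.le] at h1
    rw [mem_ball, dist_eq_norm]
    have h2 : (α ((y, v), τ)).1 - (y + v) =
        ((α ((y, v), τ)).1 - y - τ • v) - (1 - τ) • v := by
      rw [sub_smul, one_smul]; abel
    rw [h2]
    refine (norm_sub_le _ _).trans_lt ?_
    rw [norm_smul, Real.norm_of_nonneg (by linarith : 0 ≤ 1 - τ)]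
    change ‖(α ((y, v), τ)).1 - y - τ • v‖ ≤ _ at h1
    nlinarith
  have hcτ : ContinuousAt (fun z => (α (z, τ)).1) (y, v) := by
    have h1 : ContinuousOn (fun z => (α (z, τ)).1) (closedBall (y, v) r) :=
      (hc.comp (by fun_prop : Continuous fun z : (Fin n → ℝ) × (Fin n → ℝ) =>
        (z, τ)).continuousOn fun z hz => ⟨hz, by linarith, hτε⟩).fst
    exact h1.continuousAt (closedBall_mem_nhds _ hr)
  have hconst : ∀ z ∈ closedBall (y, v) r, quad (H (α (z, τ)).1) (α (z, τ)).2 =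
      quad (H z.1) z.2 := fun z hzr => by
    have hd : ∀ t ∈ Set.Icc 0 τ,
        HasDerivAt (fun s => quad (H (α (z, s)).1) (α (z, s)).2) 0 t := fun t ht => by
      obtain ⟨h1, h2⟩ := (hα z hzr).2 t ⟨by linarith [ht.1], ht.2.trans hτε⟩
      have hxt : HasDerivAt (fun s => (α (z, s)).1) (α (z, t)).2 t := h1.fst
      have hvt : HasDerivAt (fun s => (α (z, s)).2) (F (α (z, t))).2 t := h1.snd
      refine (hasDerivAt_quad_curve (K := H) (hH _ h2.1) (hHs _ h2.1) hxt hvt).congr_deriv ?_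
      rw [hkill _ h2.1]
      simp [hF, geodField, mulVec_neg]
    have h3 := constant_of_has_deriv_right_zero
      (fun t ht => (hd t ht).continuousAt.continuousWithinAt)
      (fun t ht => (hd t (Set.Ico_subset_Icc_self ht)).hasDerivWithinAt) τ ⟨hτ0.le, le_rfl⟩
    rwa [(hα z hzr).1] at h3
  have hquad : ∀ᶠ z in 𝓝 (y, v), quad (H z.1) z.2 = 0 := by
    filter_upwards [closedBall_mem_nhds (y, v) hr,
      hcτ.preimage_mem_nhds (isOpen_ball.mem_nhds hτx)] with z h1 h2
    rw [← hconst z h1, hball _ h2]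
    simp [quad]
  rw [nhds_prod_eq] at hquad
  filter_upwards [hquad.curry, hUo.mem_nhds hy] with p hp hpU
  exact eq_zero_of_eventually_quad_eq_zero (hHs p hpU) hp

open Metric Filter Topology in
theorem eq_zero_of_isQuadraticIntegral (hUo : IsOpen U) (hUc : IsPreconnected U)
    (hpos : ∀ p ∈ U, (g p).PosDef)
    (hg : ∀ i j, ContDiffOn ℝ 2 (fun q => g q i j) U) (hHs : ∀ p ∈ U, (H p).IsSymm)
    (hH : ∀ p ∈ U, ∀ i j, DifferentiableAt ℝ (fun q => H q i j) p)
    (hkill : ∀ p ∈ U, IsQuadraticIntegral g H p) {p₀ : Fin n → ℝ} (hp₀ : p₀ ∈ U)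
    (h₀ : ∀ᶠ p in 𝓝 p₀, H p = 0) {p : Fin n → ℝ} (hp : p ∈ U) : H p = 0 := by
  set W := interior {p | H p = 0} with hW
  have hWmem : ∀ {q}, q ∈ W ↔ ∀ᶠ p in 𝓝 q, H p = 0 := mem_interior_iff_mem_nhds
  suffices hUW : U ⊆ W from interior_subset (s := {p | H p = 0}) (hUW hp)
  refine hUc.subset_of_closure_inter_subset isOpen_interior ⟨p₀, hp₀, hWmem.mpr h₀⟩ ?_
  rintro x ⟨hxW, hxU⟩
  by_contra hx
  obtain ⟨ρ, hρ, hρU⟩ := Metric.isOpen_iff.mp hUo x hxU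
  obtain ⟨q, hqW, hq⟩ := Metric.mem_closure_iff.mp hxW (ρ / 2) (by positivity)
  obtain ⟨y, hyW, hy⟩ := (isOpen_interior.isClosed_compl : IsClosed Wᶜ).exists_infDist_eq_dist
    ⟨x, hx⟩ q
  have hqy : dist q y ≤ dist q x := hy ▸ infDist_le_dist_of_mem hx
  have hyU : y ∈ U := hρU (by
    rw [mem_ball]
    linarith [dist_triangle_left y x q, dist_comm x q])
  have hne : q - y ≠ 0 := fun h => hyW (sub_eq_zero.mp h ▸ hqW)
  refine hyW (hWmem.mpr (eventually_eq_zero_of_ball hUo hpos hg hHs hH hkill hyU hne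
    fun z hz => ?_))
  refine interior_subset (s := {p | H p = 0}) (ball_infDist_compl_subset (x := q) ?_)
  rwa [hy, dist_eq_norm, ← add_sub_cancel y q, add_sub_cancel_left]

end flow

section projective

variable {n : ℕ} {U : Set (Fin n → ℝ)} {g gbar H K : (Fin n → ℝ) → Matrix (Fin n) (Fin n) ℝ}
  {ω ωbar : (Fin n → ℝ) → (Fin n → ℝ)} {p : Fin n → ℝ}

theorem IsRandersDatum.differentiableAt (hd : IsRandersDatum U g ω) (hU : IsOpen U)
    (hp : p ∈ U) (i j : Fin n) : DifferentiableAt ℝ (fun q => g q i j) p :=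
  ((hd.2.1 i j).contDiffAt (hU.mem_nhds hp)).differentiableAt (by norm_num)

open Topology in
theorem IsRandersDatum.exists_geodesic (hd : IsRandersDatum U g ω) (hU : IsOpen U)
    (hp : p ∈ U) {v : Fin n → ℝ} (hv : v ≠ 0) :
    ∃ I x, IsRandersGeodesic U g ω I x ∧ (0 : ℝ) ∈ I ∧ x 0 = p ∧ deriv x 0 = v ∧
      deriv (deriv x) 0 = -arrayQuad (christoffel (g p) (gder g p)) v -
        √(quad (g p) v) • (((g p)⁻¹ * dform ω p) *ᵥ v) := by
  have hF : ContDiffAt ℝ 1 (geodField g fun p => (g p)⁻¹ * dform ω p) (p, v) :=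
    contDiffAt_geodField hU (fun p hp => (hd.1 p hp).2) hd.2.1 hp hv
      (hd.contDiffAt_inv_mul_dform hU hp)
  have hO : U ×ˢ {w : Fin n → ℝ | w ≠ 0} ∈ 𝓝 (p, v) :=
    prod_mem_nhds (hU.mem_nhds hp) (isOpen_ne.mem_nhds hv)
  obtain ⟨r, hr, ε, hε, α, hα, -⟩ := hF.exists_continuousOn_flow hO
  obtain ⟨h0, hα⟩ := hα _ (Metric.mem_closedBall_self hr.le)
  obtain ⟨h1, h2, h3⟩ := isRandersGeodesic_of_solution hU hd (α := fun t => α ((p, v), t))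
    (I := Set.Ioo (-ε) ε) isOpen_Ioo Set.ordConnected_Ioo
    (fun t ht => (hα t (Set.Ioo_subset_Icc_self ht)).1)
    (fun t ht => (hα t (Set.Ioo_subset_Icc_self ht)).2.1)
    (fun t ht => (hα t (Set.Ioo_subset_Icc_self ht)).2.2)
  have h0I : (0 : ℝ) ∈ Set.Ioo (-ε) ε := ⟨by linarith, hε⟩
  refine ⟨_, _, h1, h0I, ?_, ?_, ?_⟩
  · rw [h0]
  · rw [h2 0 h0I, h0]
  · rw [h3 0 h0I, h0]; rfl

theorem projective_pointwise_relation (hn : 2 ≤ n) (hU : IsOpen U)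
    (hd : IsRandersDatum U g ω) (hdbar : IsRandersDatum U gbar ωbar)
    (hproj : ∀ (I : Set ℝ) (x : ℝ → (Fin n → ℝ)), IsRandersGeodesic U g ω I x →
      IsRandersGeodesic U gbar ωbar I x ∨ IsRandersGeodesic U gbar (fun p => -(ωbar p)) I x)
    (hp : p ∈ U) :
    (∀ v i j, arrayQuad (christoffel (gbar p) (gder gbar p) - christoffel (g p) (gder g p)) v i
        * v j - arrayQuad (christoffel (gbar p) (gder gbar p) - christoffel (g p) (gder g p)) v j
        * v i = 0) ∧
      (dform ω p = 0 → dform ωbar p = 0) ∧ (dform ω p ≠ 0 → ∃ κ : ℝ, 0 < κ ∧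
        g p = κ • gbar p ∧ (dform ω p = √κ • dform ωbar p ∨ dform ω p = -(√κ • dform ωbar p))) := by
  refine pointwise_relation hn (hd.1 p hp).1 (hd.1 p hp).2 (hdbar.1 p hp).1 (hdbar.1 p hp).2
    (dform_transpose ω p) (dform_transpose ωbar p) (arrayQuad_neg _) (polyOnLines_arrayQuad _)
    (continuous_arrayQuad _) fun v hv => ?_
  obtain ⟨I, x, hx, h0, rfl, rfl, ha⟩ := hd.exists_geodesic hU hp hv
  rw [arrayQuad_sub]
  rcases hproj I x hx with h | h
  · obtain ⟨r, hr⟩ := h.exists_smul_eq (fun p hp => (hdbar.1 p hp).2) h0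
    refine ⟨1, Or.inl rfl, r, ?_⟩
    rw [← hr, ha, one_mul]
    abel
  · obtain ⟨r, hr⟩ := h.exists_smul_eq (fun p hp => (hdbar.1 p hp).2) h0
    refine ⟨-1, Or.inr rfl, r, ?_⟩
    rw [← hr, ha, dform_neg, mul_neg, neg_mulVec, smul_neg, neg_one_mul, neg_smul]
    abel

theorem gder_smul {l : (Fin n → ℝ) → ℝ} (hl : DifferentiableAt ℝ l p)
    (hH : ∀ i j, DifferentiableAt ℝ (fun q => H q i j) p) (k : Fin n) :
    gder (fun q => l q • H q) p k = dpart l k p • H p + l p • gder H p k := by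
  ext i j
  have h := (hl.hasFDerivAt.mul (hH i j).hasFDerivAt).fderiv
  change fderiv ℝ (fun q => l q * H q i j) p (Pi.single k 1) = _
  rw [show (fun q => l q * H q i j) = l * fun q => H q i j from rfl, h]
  simp [gder, dpart]
  ring

open Topology in
theorem IsQuadraticIntegral.congr (h : IsQuadraticIntegral g H p) (hHK : H =ᶠ[𝓝 p] K) :
    IsQuadraticIntegral g K p := by
  have h1 : gder H p = gder K p := by
    funext k
    ext i j
    simp only [gder, of_apply, dpart]
    rw [Filter.EventuallyEq.fderiv_eq (hHK.mono fun q hq => by rw [hq])]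
  intro v
  rw [← h1, ← hHK.eq_of_nhds]
  exact h v

theorem isQuadraticIntegral_self (hg : (g p).PosDef) : IsQuadraticIntegral g g p := fun v => by
  rw [dotProduct_mulVec_arrayQuad_christoffel hg]
  ring

theorem IsQuadraticIntegral.sub_smul (hH : IsQuadraticIntegral g H p)
    (hK : IsQuadraticIntegral g K p) (hdH : ∀ i j, DifferentiableAt ℝ (fun q => H q i j) p)
    (hdK : ∀ i j, DifferentiableAt ℝ (fun q => K q i j) p) (C : ℝ) :
    IsQuadraticIntegral g (fun q => H q - C • K q) p := fun v => by
  have h1 : gder (fun q => H q - C • K q) p = fun k => gder H p k - C • gder K p k := by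
    funext k
    ext i j
    have h := ((hdH i j).hasFDerivAt.sub ((hdK i j).hasFDerivAt.const_mul C)).fderiv
    change fderiv ℝ ((fun q => H q i j) - fun q => C * K q i j) p (Pi.single k 1) = _
    rw [h]
    simp [gder, dpart]
  simp only [h1, quad_sub_matrix, quad_smul_matrix, sub_mulVec, smul_mulVec, dotProduct_sub,
    dotProduct_smul, smul_eq_mul]
  have e : ∑ k, v k * (quad (gder H p k) v - C * quad (gder K p k) v) =
      ∑ k, v k * quad (gder H p k) v - C * ∑ k, v k * quad (gder K p k) v := by
    rw [Finset.mul_sum, ← Finset.sum_sub_distrib]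
    exact Finset.sum_congr rfl fun k _ => by ring
  rw [e, hH v, hK v]
  ring

theorem quad_add_matrix (G G' : Matrix (Fin n) (Fin n) ℝ) (v : Fin n → ℝ) :
    quad (G + G') v = quad G v + quad G' v := by
  simp [quad_eq_dotProduct, add_mulVec, dotProduct_add]

theorem fderiv_eq_zero_of_isQuadraticIntegral_smul {l : (Fin n → ℝ) → ℝ} (hg : (g p).PosDef)
    (hl : DifferentiableAt ℝ l p) (hdg : ∀ i j, DifferentiableAt ℝ (fun q => g q i j) p)
    (h : IsQuadraticIntegral g (fun q => l q • g q) p) : fderiv ℝ l p = 0 := by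
  ext v
  by_cases hv : v = 0
  · simp [hv]
  have h1 := h v
  simp only [gder_smul hl hdg, quad_add_matrix, quad_smul_matrix, smul_mulVec, dotProduct_smul,
    smul_eq_mul, dotProduct_mulVec_arrayQuad_christoffel hg] at h1
  have e : ∑ k, v k * (dpart l k p * quad (g p) v + l p * quad (gder g p k) v) =
      (∑ k, v k * dpart l k p) * quad (g p) v + l p * ∑ k, v k * quad (gder g p k) v := by
    rw [Finset.mul_sum, Finset.sum_mul, ← Finset.sum_add_distrib]
    exact Finset.sum_congr rfl fun k _ => by ring
  rw [e] at h1
  have h2 : (∑ k, v k * dpart l k p) * quad (g p) v = 0 := by linarith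
  rw [fderiv_apply_eq_sum_dpart, (mul_eq_zero.mp h2).resolve_right (quad_pos hg hv).ne']
  rfl

/-- The factor turning `H` into a quadratic integral of the geodesics of `g` when the two metrics
are projectively equivalent. -/
noncomputable def integralFactor (g H : (Fin n → ℝ) → Matrix (Fin n) (Fin n) ℝ)
    (p : Fin n → ℝ) : ℝ :=
  Real.exp (2 / ((n : ℝ) + 1) * (Real.log (g p).det - Real.log (H p).det))

theorem differentiableAt_log_det (hH : (H p).PosDef)
    (hdH : ∀ i j, DifferentiableAt ℝ (fun q => H q i j) p) :
    DifferentiableAt ℝ (fun q => Real.log (H q).det) p := by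
  refine DifferentiableAt.log ?_ hH.det_pos.ne'
  simp only [Matrix.det_apply']
  fun_prop

theorem differentiableAt_integralFactor (hg : (g p).PosDef) (hH : (H p).PosDef)
    (hdg : ∀ i j, DifferentiableAt ℝ (fun q => g q i j) p)
    (hdH : ∀ i j, DifferentiableAt ℝ (fun q => H q i j) p) :
    DifferentiableAt ℝ (integralFactor g H) p :=
  (((differentiableAt_log_det hg hdg).sub (differentiableAt_log_det hH hdH)).const_mul _).exp

theorem dpart_integralFactor (hg : (g p).PosDef) (hH : (H p).PosDef)
    (hdg : ∀ i j, DifferentiableAt ℝ (fun q => g q i j) p)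
    (hdH : ∀ i j, DifferentiableAt ℝ (fun q => H q i j) p) (k : Fin n) :
    dpart (integralFactor g H) k p = integralFactor g H p * (2 / ((n : ℝ) + 1) *
      (((g p)⁻¹ * gder g p k).trace - ((H p)⁻¹ * gder H p k).trace)) := by
  rw [← dpart_log_det hdg hg.det_pos, ← dpart_log_det hdH hH.det_pos]
  have h := (((differentiableAt_log_det hg hdg).hasFDerivAt.sub
    (differentiableAt_log_det hH hdH).hasFDerivAt).const_mul (2 / ((n : ℝ) + 1))).exp.fderiv
  change fderiv ℝ (fun q => Real.exp (2 / ((n : ℝ) + 1) *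
    ((fun q => Real.log (g q).det) - fun q => Real.log (H q).det) q)) p (Pi.single k 1) = _
  rw [h]
  simp [dpart, integralFactor]

theorem isQuadraticIntegral_integralFactor_smul (hg : (g p).IsSymm ∧ (g p).PosDef)
    (hH : (H p).IsSymm ∧ (H p).PosDef)
    (hdg : ∀ i j, DifferentiableAt ℝ (fun q => g q i j) p)
    (hdH : ∀ i j, DifferentiableAt ℝ (fun q => H q i j) p)
    (hgs : ∀ k, (gder g p k).IsSymm) (hHs : ∀ k, (gder H p k).IsSymm)
    (h : ∀ v i j, arrayQuad (christoffel (H p) (gder H p) - christoffel (g p) (gder g p)) v i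
        * v j - arrayQuad (christoffel (H p) (gder H p) - christoffel (g p) (gder g p)) v j
        * v i = 0) :
    IsQuadraticIntegral g (fun q => integralFactor g H q • H q) p := fun v => by
  have h1 := killing_of_parallel hg.1 hH.1 hH.2 hgs hHs h
    (dpart_integralFactor hg.2 hH.2 hdg hdH) v
  simp only [gder_smul (differentiableAt_integralFactor hg.2 hH.2 hdg hdH) hdH, quad_add_matrix,
    quad_smul_matrix, smul_mulVec, dotProduct_smul, smul_eq_mul]
  linarith

end projective

section conclusion

variable {n : ℕ} {U : Set (Fin n → ℝ)} {g H : (Fin n → ℝ) → Matrix (Fin n) (Fin n) ℝ}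

open Topology in
theorem exists_eventually_smul_eq (hn : 2 ≤ n) (hg : ∀ p ∈ U, (g p).PosDef)
    (hH : ∀ p ∈ U, (H p).PosDef)
    (hdg : ∀ p ∈ U, ∀ i j, DifferentiableAt ℝ (fun q => g q i j) p)
    (hdH : ∀ p ∈ U, ∀ i j, DifferentiableAt ℝ (fun q => H q i j) p)
    (hkill : ∀ p ∈ U, IsQuadraticIntegral g (fun q => integralFactor g H q • H q) p)
    {p₀ : Fin n → ℝ} (hU : U ∈ 𝓝 p₀) (h : ∀ᶠ p in 𝓝 p₀, ∃ κ : ℝ, g p = κ • H p) :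
    ∃ C : ℝ, 0 < C ∧ ∀ᶠ p in 𝓝 p₀, integralFactor g H p • H p = C • g p := by
  let a : Fin n := ⟨0, by omega⟩
  set l : (Fin n → ℝ) → ℝ := fun p => integralFactor g H p * (H p a a * (g p a a)⁻¹) with hl
  obtain ⟨δ, hδ, hball⟩ := Metric.mem_nhds_iff.mp (Filter.inter_mem hU h)
  have hBU : ∀ p ∈ Metric.ball p₀ δ, p ∈ U := fun p hp => (hball hp).1
  have heq : ∀ p ∈ Metric.ball p₀ δ, integralFactor g H p • H p = l p • g p := fun p hp => by
    obtain ⟨hpU, κ, hκ⟩ := hball hp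
    have hHa : H p a a ≠ 0 := ((hH p hpU).diag_pos (i := a)).ne'
    have hga : κ * H p a a ≠ 0 := by
      have := ((hg p hpU).diag_pos (i := a)).ne'
      rwa [hκ] at this
    have hκ0 : κ ≠ 0 := left_ne_zero_of_mul hga
    have h1 : l p = integralFactor g H p / κ := by
      simp only [hl, hκ, Matrix.smul_apply, smul_eq_mul]
      field_simp
    rw [h1, hκ, smul_smul, div_mul_cancel₀ _ hκ0]
  have hld : ∀ p ∈ Metric.ball p₀ δ, DifferentiableAt ℝ l p := fun p hp => by
    have hpU := hBU p hp
    exact (differentiableAt_integralFactor (hg p hpU) (hH p hpU) (hdg p hpU) (hdH p hpU)).mul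
      ((hdH p hpU a a).mul ((hdg p hpU a a).inv ((hg p hpU).diag_pos (i := a)).ne'))
  have hl0 : ∀ p ∈ Metric.ball p₀ δ, fderiv ℝ l p = 0 := fun p hp =>
    fderiv_eq_zero_of_isQuadraticIntegral_smul (hg p (hBU p hp)) (hld p hp) (hdg p (hBU p hp))
      ((hkill p (hBU p hp)).congr
        (Filter.eventually_of_mem (Metric.isOpen_ball.mem_nhds hp) heq))
  have hp₀ : p₀ ∈ Metric.ball p₀ δ := Metric.mem_ball_self hδ
  refine ⟨l p₀, mul_pos (Real.exp_pos _) (mul_pos (hH p₀ (hBU _ hp₀)).diag_pos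
    (inv_pos.mpr (hg p₀ (hBU _ hp₀)).diag_pos)), ?_⟩
  filter_upwards [Metric.ball_mem_nhds p₀ hδ] with p hp
  rw [heq p hp, Metric.isOpen_ball.is_const_of_fderiv_eq_zero
    (convex_ball p₀ δ).isPreconnected (fun q hq => (hld q hq).differentiableWithinAt) hl0 hp hp₀]

theorem eq_exp_smul_of_integralFactor_smul_eq (hn : 2 ≤ n) {C : ℝ} (hC : 0 < C) {p : Fin n → ℝ}
    (hH : (H p).PosDef) (h : integralFactor g H p • H p = C • g p) :
    g p = Real.exp (((n : ℝ) + 1) / ((n : ℝ) - 1) * Real.log C) • H p := by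
  have hn' : (0 : ℝ) < (n : ℝ) - 1 := by
    have : (2 : ℝ) ≤ n := by exact_mod_cast hn
    linarith
  have hl : 0 < integralFactor g H p := Real.exp_pos _
  set κ := integralFactor g H p / C with hκ
  have hκ0 : 0 < κ := div_pos hl hC
  have hg : g p = κ • H p := by
    rw [hκ, div_eq_inv_mul, mul_smul, h, smul_smul, inv_mul_cancel₀ hC.ne', one_smul]
  have hdet : Real.log (g p).det = n * Real.log κ + Real.log (H p).det := by
    rw [hg, Matrix.det_smul, Fintype.card_fin,
      Real.log_mul (pow_ne_zero _ hκ0.ne') hH.det_pos.ne', Real.log_pow]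
  have h1 : Real.log κ = 2 / ((n : ℝ) + 1) * (n * Real.log κ) - Real.log C := by
    conv_lhs => rw [hκ, Real.log_div hl.ne' hC.ne', integralFactor, Real.log_exp, hdet]
    ring
  have h2 : ((n : ℝ) + 1) / ((n : ℝ) - 1) * Real.log C = Real.log κ := by
    field_simp at h1 ⊢
    linarith
  rw [h2, Real.exp_log hκ0, ← hg]

end conclusion

/-- Corollary 5 of the paper: if two Randers data on a connected open set are pointwise
projectively related and `ω` is not closed, then the Riemannian parts are proportional with
a constant positive coefficient and at every point `dω = ±c·dω̄`. -/
theorem stmt_12 (n : ℕ) (hn : 2 ≤ n) (U : Set (Fin n → ℝ))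
    (hUopen : IsOpen U) (hUconn : IsConnected U)
    (g gbar : (Fin n → ℝ) → Matrix (Fin n) (Fin n) ℝ)
    (ω ωbar : (Fin n → ℝ) → (Fin n → ℝ))
    (hdatum : IsRandersDatum U g ω) (hdatumbar : IsRandersDatum U gbar ωbar)
    (hproj : ∀ (I : Set ℝ) (x : ℝ → (Fin n → ℝ)),
      IsRandersGeodesic U g ω I x →
        IsRandersGeodesic U gbar ωbar I x ∨
        IsRandersGeodesic U gbar (fun p => -(ωbar p)) I x)
    (hnotclosed : ¬ IsClosedFormOn U ω) :
    ∃ c : ℝ, 0 < c ∧ (∀ p ∈ U, g p = (c ^ 2) • gbar p) ∧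
      ∀ p ∈ U, dform ω p = c • dform ωbar p ∨ dform ω p = -(c • dform ωbar p) := by
  have hpt := fun p (hp : p ∈ U) =>
    projective_pointwise_relation hn hUopen hdatum hdatumbar hproj hp
  have hg : ∀ p ∈ U, (g p).PosDef := fun p hp => (hdatum.1 p hp).2
  have hH : ∀ p ∈ U, (gbar p).PosDef := fun p hp => (hdatumbar.1 p hp).2
  have hdg := fun p (hp : p ∈ U) => hdatum.differentiableAt hUopen hp
  have hdH := fun p (hp : p ∈ U) => hdatumbar.differentiableAt hUopen hp
  have hkill : ∀ p ∈ U, IsQuadraticIntegral g (fun q => integralFactor g gbar q • gbar q) p :=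
    fun p hp => isQuadraticIntegral_integralFactor_smul (hdatum.1 p hp) (hdatumbar.1 p hp)
      (hdg p hp) (hdH p hp) (gder_isSymm hUopen (fun q hq => (hdatum.1 q hq).1) hp)
      (gder_isSymm hUopen (fun q hq => (hdatumbar.1 q hq).1) hp) (hpt p hp).1
  have hdK : ∀ p ∈ U, ∀ i j,
      DifferentiableAt ℝ (fun q => (integralFactor g gbar q • gbar q) i j) p := fun p hp i j =>
    (differentiableAt_integralFactor (hg p hp) (hH p hp) (hdg p hp) (hdH p hp)).mul (hdH p hp i j)
  simp only [IsClosedFormOn, not_forall] at hnotclosed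
  obtain ⟨p₀, hp₀, hω₀⟩ := hnotclosed
  have hnear : ∀ᶠ p in nhds p₀, ∃ κ : ℝ, g p = κ • gbar p := by
    obtain ⟨i, j, hij⟩ : ∃ i j, dform ω p₀ i j ≠ 0 := by
      by_contra! hall
      exact hω₀ (Matrix.ext hall)
    have hcont : ContinuousAt (fun p => dform ω p i j) p₀ :=
      (contDiffAt_dpart hUopen (hdatum.2.2 i) hp₀ j).continuousAt.sub
        (contDiffAt_dpart hUopen (hdatum.2.2 j) hp₀ i).continuousAt
    filter_upwards [hcont.eventually_ne hij, hUopen.mem_nhds hp₀] with p hp hpU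
    obtain ⟨κ, -, hκ, -⟩ := (hpt p hpU).2.2 fun h0 => hp (by simp [h0])
    exact ⟨κ, hκ⟩
  obtain ⟨C, hC, hev⟩ := exists_eventually_smul_eq hn hg hH hdg hdH hkill
    (hUopen.mem_nhds hp₀) hnear
  have hzero : ∀ p ∈ U, integralFactor g gbar p • gbar p - C • g p = 0 := fun p hp =>
    eq_zero_of_isQuadraticIntegral (H := fun q => integralFactor g gbar q • gbar q - C • g q)
      hUopen hUconn.isPreconnected hg hdatum.2.1
      (fun q hq => ((hdatumbar.1 q hq).1.smul _).sub ((hdatum.1 q hq).1.smul _))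
      (fun q hq i j => (hdK q hq i j).sub ((hdg q hq i j).const_mul C))
      (fun q hq => (hkill q hq).sub_smul (isQuadraticIntegral_self (hg q hq)) (hdK q hq)
        (hdg q hq) C)
      hp₀ (hev.mono fun q hq => sub_eq_zero.mpr hq) hp
  set κ := Real.exp (((n : ℝ) + 1) / ((n : ℝ) - 1) * Real.log C) with hκ
  have hκ0 : 0 < κ := Real.exp_pos _
  have hmain : ∀ p ∈ U, g p = κ • gbar p := fun p hp =>
    eq_exp_smul_of_integralFactor_smul_eq hn hC (hH p hp) (sub_eq_zero.mp (hzero p hp))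
  refine ⟨√κ, Real.sqrt_pos.mpr hκ0, fun p hp => by rw [Real.sq_sqrt hκ0.le, hmain p hp],
    fun p hp => ?_⟩
  by_cases h0 : dform ω p = 0
  · left
    rw [h0, (hpt p hp).2.1 h0, smul_zero]
  · obtain ⟨κ', -, hκ', h⟩ := (hpt p hp).2.2 h0
    have ha := (hH p hp).diag_pos (i := ⟨0, by omega⟩)
    have he := hmain p hp
    rw [hκ'] at he
    have he' := congrFun (congrFun he ⟨0, by omega⟩) ⟨0, by omega⟩
    simp only [Matrix.smul_apply, smul_eq_mul] at he'
    rwa [mul_right_cancel₀ ha.ne' he'] at h
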